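/- arXiv:math/0104151 — 12 statements merged into one kernel-verified Lean document; each statement's English description precedes it below -/
import Mathlib

section
/- Every term of a rank-2 cluster sequence with trivial coefficients is a Laurent polynomial with integer coefficients in the initial cluster variables; that is, y_m ∈ L for every m ∈ ℤ. (This is the Laurent phenomenon for cluster algebras of rank 2.) -/
/-- The ambient field: the field of rational functions in two variables over `ℤ`,
i.e. the fraction field of `ℤ[x₁, x₂]`. -/
abbrev ClusterField : Type := FractionRing (MvPolynomial (Fin 2) ℤ)

/-- The two initial cluster variables `x₁, x₂` inside the ambient field. -/
noncomputable def clusterVar (i : Fin 2) : ClusterField :=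
  algebraMap (MvPolynomial (Fin 2) ℤ) ClusterField (MvPolynomial.X i)

/-- The subring `L = ℤ[x₁^{±1}, x₂^{±1}]` of Laurent polynomials in the
initial cluster variables. -/
noncomputable def laurentSubring : Subring ClusterField :=
  Subring.closure {clusterVar 0, clusterVar 1, (clusterVar 0)⁻¹, (clusterVar 1)⁻¹}

theorem key_step (S : Subring ClusterField) (p q : ℕ) (h : p = 0 ∨ 0 < q)
    (y0 y1 y2 y3 y4 : ClusterField)
    (h1 : y0 * y2 = y1 ^ p + 1) (h2 : y1 * y3 = y2 ^ q + 1) (h3 : y2 * y4 = y3 ^ p + 1)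
    (hz : y2 ≠ 0) (m0 : y0 ∈ S) (m2 : y2 ∈ S) (m3 : y3 ∈ S) : y4 ∈ S := by
  rcases h with h | h
  · subst h
    have : y4 = y0 := by
      apply mul_left_cancel₀ hz
      rw [h3, mul_comm, h1]; simp
    rwa [this]
  · obtain ⟨n, rfl⟩ : ∃ n, q = n + 1 := ⟨q - 1, by omega⟩
    have e : (y2 ^ (n + 1) + 1) ^ p - 1
        = y2 * (y2 ^ n * ∑ i ∈ Finset.range p, (y2 ^ (n + 1) + 1) ^ i) := by
      have := geom_sum_mul (y2 ^ (n + 1) + 1) p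
      rw [← this]; ring
    have : y4 = y0 * y3 ^ p - y2 ^ n * ∑ i ∈ Finset.range p, (y2 ^ (n + 1) + 1) ^ i := by
      apply mul_left_cancel₀ hz
      rw [h3, mul_sub, ← e, ← h2, mul_pow]
      linear_combination (-y3 ^ p) * h1
    rw [this]
    refine S.sub_mem (S.mul_mem m0 (S.pow_mem m3 _)) (S.mul_mem (S.pow_mem m2 _) ?_)
    exact S.sum_mem fun i _ => S.pow_mem (S.add_mem (S.pow_mem m2 _) S.one_mem) _

/-- ratios of polynomials positive at the point `(1,1)` -/
def PosRat (f : ClusterField) : Prop :=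
  ∃ p q : MvPolynomial (Fin 2) ℤ, 0 < MvPolynomial.eval (fun _ => (1 : ℤ)) p ∧
    0 < MvPolynomial.eval (fun _ => (1 : ℤ)) q ∧
    f * algebraMap _ ClusterField q = algebraMap _ ClusterField p

theorem PosRat.ne_zero {f : ClusterField} (h : PosRat f) : f ≠ 0 := by
  rintro rfl
  obtain ⟨p, q, hp, hq, e⟩ := h
  rw [zero_mul, eq_comm, FaithfulSMul.algebraMap_eq_zero_iff] at e
  simp [e] at hp

theorem PosRat.one : PosRat 1 := ⟨1, 1, by simp, by simp, by simp⟩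

theorem PosRat.var (i : Fin 2) : PosRat (clusterVar i) :=
  ⟨MvPolynomial.X i, 1, by simp, by simp, by simp [clusterVar]⟩

theorem PosRat.mul {f g : ClusterField} (hf : PosRat f) (hg : PosRat g) : PosRat (f * g) := by
  obtain ⟨p, q, hp, hq, e⟩ := hf
  obtain ⟨p', q', hp', hq', e'⟩ := hg
  refine ⟨p * p', q * q', ?_, ?_, ?_⟩
  · rw [map_mul]; positivity
  · rw [map_mul]; positivity
  · rw [map_mul, map_mul, ← e, ← e']; ring

theorem PosRat.add {f g : ClusterField} (hf : PosRat f) (hg : PosRat g) : PosRat (f + g) := by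
  obtain ⟨p, q, hp, hq, e⟩ := hf
  obtain ⟨p', q', hp', hq', e'⟩ := hg
  refine ⟨p * q' + p' * q, q * q', ?_, ?_, ?_⟩
  · rw [map_add, map_mul, map_mul]; positivity
  · rw [map_mul]; positivity
  · rw [map_add, map_mul, map_mul, map_mul, ← e, ← e']; ring

theorem PosRat.pow {f : ClusterField} (hf : PosRat f) (n : ℕ) : PosRat (f ^ n) := by
  induction n with
  | zero => simpa using PosRat.one
  | succ n ih => rw [pow_succ]; exact ih.mul hf

theorem PosRat.of_mul {f g : ClusterField} (hf : PosRat f) (hg : PosRat (f * g)) :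
    PosRat g := by
  obtain ⟨p, q, hp, hq, e⟩ := hf
  obtain ⟨p', q', hp', hq', e'⟩ := hg
  refine ⟨p' * q, p * q', ?_, ?_, ?_⟩
  · rw [map_mul]; positivity
  · rw [map_mul]; positivity
  · rw [map_mul, map_mul, ← e, ← e']; ring

/-- **The Laurent phenomenon in rank 2.**  Every term of a rank-2 cluster
sequence with trivial coefficients is a Laurent polynomial with integer
coefficients in the initial cluster variables. -/
theorem laurent_phenomenon_rank_two
    (b c : ℕ) (hbc : (0 < b ∧ 0 < c) ∨ (b = 0 ∧ c = 0))
    (y : ℤ → ClusterField)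
    (hy1 : y 1 = clusterVar 0) (hy2 : y 2 = clusterVar 1)
    (hodd : ∀ m : ℤ, Odd m → y (m - 1) * y (m + 1) = y m ^ b + 1)
    (heven : ∀ m : ℤ, Even m → y (m - 1) * y (m + 1) = y m ^ c + 1) :
    ∀ m : ℤ, y m ∈ laurentSubring := by
  obtain ⟨e, he, h, hper⟩ : ∃ e : ℤ → ℕ, (∀ m, e m = 0 ∨ 0 < e (m + 1)) ∧
      (∀ m, y m * y (m + 2) = y (m + 1) ^ e (m + 1) + 1) ∧ ∀ m, e (m + 2) = e m := by
    refine ⟨fun m => if Even m then c else b, ?_, ?_, ?_⟩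
    · intro m
      dsimp only
      split_ifs <;> omega
    · intro m
      by_cases hm : Even (m + 1)
      · have := heven _ hm
        rw [add_sub_cancel_right, add_assoc] at this
        simpa [hm] using this
      · have := hodd _ (Int.not_even_iff_odd.mp hm)
        rw [add_sub_cancel_right, add_assoc] at this
        simpa [hm] using this
    · intro m
      simp
  have hpos : ∀ m : ℤ, PosRat (y m) ∧ PosRat (y (m + 1)) := by
    intro m
    induction m using Int.inductionOn' (b := 1) with
    | zero =>
      rw [hy1, show (1 : ℤ) + 1 = 2 by rfl, hy2]
      exact ⟨PosRat.var 0, PosRat.var 1⟩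
    | succ k _ ih =>
      refine ⟨ih.2, ih.1.of_mul ?_⟩
      rw [add_assoc, show (1 : ℤ) + 1 = 2 by rfl, h]
      exact (ih.2.pow _).add PosRat.one
    | pred k _ ih =>
      rw [sub_add_cancel]
      refine ⟨ih.2.of_mul ?_, ih.1⟩
      have := h (k - 1)
      rw [sub_add_cancel, show k - 1 + 2 = k + 1 by ring] at this
      rw [mul_comm, this]
      exact (ih.1.pow _).add PosRat.one
  have hnz : ∀ m, y m ≠ 0 := fun m => (hpos m).1.ne_zero
  have g1 : y 1 ∈ laurentSubring := by
    rw [hy1]; exact Subring.subset_closure (by simp)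
  have g2 : y 2 ∈ laurentSubring := by
    rw [hy2]; exact Subring.subset_closure (by simp)
  have i1 : (y 1)⁻¹ ∈ laurentSubring := by
    rw [hy1]; exact Subring.subset_closure (by simp)
  have i2 : (y 2)⁻¹ ∈ laurentSubring := by
    rw [hy2]; exact Subring.subset_closure (by simp)
  have g0 : y 0 ∈ laurentSubring := by
    have h0 : y 0 * y 2 = y 1 ^ e 1 + 1 := h 0
    rw [(eq_mul_inv_iff_mul_eq₀ (hnz 2)).2 h0]
    exact mul_mem (add_mem (pow_mem g1 _) (one_mem _)) i2
  have g3 : y 3 ∈ laurentSubring := by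
    have h0 : y 1 * y 3 = y 2 ^ e 2 + 1 := h 1
    rw [mul_comm] at h0
    rw [(eq_mul_inv_iff_mul_eq₀ (hnz 1)).2 h0]
    exact mul_mem (add_mem (pow_mem g2 _) (one_mem _)) i1
  have main : ∀ m : ℤ, y m ∈ laurentSubring ∧ y (m + 1) ∈ laurentSubring ∧
      y (m + 2) ∈ laurentSubring ∧ y (m + 3) ∈ laurentSubring := by
    intro m
    induction m using Int.inductionOn' (b := 0) with
    | zero => exact ⟨g0, g1, g2, g3⟩
    | succ k _ ih =>
      obtain ⟨a0, a1, a2, a3⟩ := ih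
      rw [show k + 1 + 1 = k + 2 by ring, show k + 1 + 2 = k + 3 by ring,
        show k + 1 + 3 = k + 4 by ring]
      refine ⟨a1, a2, a3, key_step _ (e (k + 1)) (e (k + 2)) ?_ (y k) (y (k + 1)) (y (k + 2))
        (y (k + 3)) _ (h k) ?_ ?_ (hnz _) a0 a2 a3⟩
      · have := he (k + 1)
        rwa [show k + 1 + 1 = k + 2 by ring] at this
      · have := h (k + 1)
        rwa [show k + 1 + 1 = k + 2 by ring, show k + 1 + 2 = k + 3 by ring] at this
      · have := h (k + 2)
        rwa [show k + 2 + 1 = k + 1 + 2 by ring, hper, show k + 2 + 2 = k + 4 by ring,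
          show k + 1 + 2 = k + 3 by ring] at this
    | pred k _ ih =>
      obtain ⟨a0, a1, a2, a3⟩ := ih
      rw [show k - 1 + 1 = k by ring, show k - 1 + 2 = k + 1 by ring,
        show k - 1 + 3 = k + 2 by ring]
      refine ⟨key_step _ (e k) (e (k + 1)) (he k) (y (k + 3)) (y (k + 2)) (y (k + 1))
        (y k) _ ?_ ?_ ?_ (hnz _) a3 a1 a0, a0, a1, a2⟩
      · have := h (k + 1)
        rw [show k + 1 + 1 = k + 2 by ring, hper, show k + 1 + 2 = k + 3 by ring] at this
        rw [mul_comm, this]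
      · rw [mul_comm, h]
      · have := h (k - 1)
        rw [show k - 1 + 1 = k by ring, show k - 1 + 2 = k + 1 by ring] at this
        rw [mul_comm, this]
  exact fun m => (main m).1
end

section
/- Suppose bc ≥ 4. Then for every integer m ≥ 0 one has δ(m+3) = w1(m) α_{⟨m+1⟩} and δ(−m) = w2(m) α_{⟨m+2⟩}; in particular, the map δ : ℤ → Q is injective, i.e., all vectors δ(m), m ∈ ℤ, are distinct. -/
/-- Componentwise positive part `[v]₊` of a vector in the root lattice `Q = ℤ²`
(coordinates with respect to the simple roots `α₁, α₂`). -/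
def vecPosPart (v : ℤ × ℤ) : ℤ × ℤ := (max v.1 0, max v.2 0)

/-- The simple reflection `s₁`, acting in the basis `(α₁, α₂)` by the matrix
`[[-1, b], [0, 1]]`. -/
def refl1 (b : ℤ) (v : ℤ × ℤ) : ℤ × ℤ := (-v.1 + b * v.2, v.2)

/-- The simple reflection `s₂`, acting in the basis `(α₁, α₂)` by the matrix
`[[1, 0], [c, -1]]`. -/
def refl2 (c : ℤ) (v : ℤ × ℤ) : ℤ × ℤ := (v.1, c * v.1 - v.2)

/-- `w1 b c m` is the alternating product `s₁ s₂ s₁ ⋯` of length `m`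
beginning with `s₁` (so the `j`-th factor is `s₁` for `j` odd and `s₂` for `j` even). -/
def w1 (b c : ℤ) : ℕ → ℤ × ℤ → ℤ × ℤ
  | 0 => id
  | m + 1 => w1 b c m ∘ (if m % 2 = 0 then refl1 b else refl2 c)

/-- `w2 b c m` is the alternating product `s₂ s₁ s₂ ⋯` of length `m`
beginning with `s₂`. -/
def w2 (b c : ℤ) : ℕ → ℤ × ℤ → ℤ × ℤ
  | 0 => id
  | m + 1 => w2 b c m ∘ (if m % 2 = 0 then refl2 c else refl1 b)

lemma aux_growth (n : ℕ) : ∀ (p q : ℤ), 0 < p → 0 < q → 4 ≤ p * q → ∀ f : ℕ → ℤ,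
    (∀ n, f (n + 2) = (if n % 2 = 0 then q else p) * f (n + 1) - f n) →
    0 ≤ f 0 → 0 < f 1 → p * f 0 ≤ 2 * f 1 → 0 ≤ f n ∧ 0 < f (n + 1) := by
  induction n with
  | zero => intro p q _ _ _ f _ h0 h1 _; exact ⟨h0, h1⟩
  | succ n ih =>
    intro p q hp hq h f hf h0 h1 h2
    have e := hf 0
    simp at e
    have h3 : q * (p * f 0) ≤ q * (2 * f 1) := mul_le_mul_of_nonneg_left h2 hq.le
    have h4 : 4 * f 0 ≤ (p * q) * f 0 := mul_le_mul_of_nonneg_right h h0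
    have h5 : 2 * f 0 ≤ q * f 1 := by nlinarith
    have h6 : 0 < q * f 1 := mul_pos hq h1
    refine ih q p hq hp (by linarith) (fun k => f (k + 1)) ?_ h1.le ?_ ?_
    · intro k
      have := hf (k + 1)
      simp only [show k + 2 + 1 = k + 1 + 2 by ring, this]
      rcases Nat.mod_two_eq_zero_or_one k with hk | hk
      · have : (k + 1) % 2 = 1 := by omega
        simp [hk, this]
      · have : (k + 1) % 2 = 0 := by omega
        simp [hk, this]
    · show 0 < f 2
      linarith
    · show q * f 1 ≤ 2 * f 2
      linarith

lemma aux_seq (p q : ℤ) (hp : 0 < p) (hq : 0 < q) (h : 4 ≤ p * q) (x y : ℕ → ℤ)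
    (hx : ∀ n, x (n + 2) = (if n % 2 = 0 then q else p) * x (n + 1) - x n)
    (hy : ∀ n, y (n + 2) = (if n % 2 = 0 then q else p) * y (n + 1) - y n)
    (x0 : x 0 = 1) (x1 : x 1 = p) (y0 : y 0 = 0) (y1 : y 1 = 1) :
    (∀ n, 0 ≤ x n ∧ 0 ≤ y n ∧ p * y n < 2 * x n) ∧
    (∀ i j, x i = x j → y i = y j → i = j) := by
  constructor
  · intro n
    refine ⟨(aux_growth n p q hp hq h x hx (by simp [x0]) (by simpa [x1]) (by
      rw [x0, x1]; linarith)).1, (aux_growth n p q hp hq h y hy (by simp [y0]) (by simp [y1]) (by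
      rw [y0, y1]; linarith)).1, ?_⟩
    have key : ∀ m, 0 < 2 * x (m + 1) - p * y (m + 1) := fun m =>
      (aux_growth m p q hp hq h (fun n => 2 * x n - p * y n)
        (by intro n; simp only [hx, hy]; ring)
        (by simp [x0, y0]) (by simp only [x1, y1]; linarith)
        (by simp only [x0, x1, y0, y1]; linarith)).2
    cases n with
    | zero => simp [x0, y0]
    | succ m => linarith [key m]
  · have det : ∀ n, x n * y (n + 1) - x (n + 1) * y n = 1 := by
      intro n
      induction n with
      | zero => simp [x0, y0, y1]
      | succ n ih => rw [hx, hy]; linarith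
    have key : ∀ i k, 0 < x i * y (i + (k + 1)) - x (i + (k + 1)) * y i := by
      intro i k
      rcases Nat.mod_two_eq_zero_or_one i with hi | hi
      · refine (aux_growth k p q hp hq h (fun k => x i * y (i + k) - x (i + k) * y i)
          ?_ ?_ ?_ ?_).2
        · intro n
          have e : (i + n) % 2 = n % 2 := by omega
          have ax := hx (i + n)
          have ay := hy (i + n)
          rw [e] at ax ay
          simp only [← add_assoc, ax, ay]; ring
        · simp
        · simp only [det]; norm_num
        · simp only [det, add_zero]; linarith
      · refine (aux_growth k q p hq hp (by linarith)
          (fun k => x i * y (i + k) - x (i + k) * y i) ?_ ?_ ?_ ?_).2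
        · intro n
          have ax := hx (i + n)
          have ay := hy (i + n)
          have e : (if (i + n) % 2 = 0 then q else p) = if n % 2 = 0 then p else q := by
            rcases Nat.mod_two_eq_zero_or_one n with hn | hn
            · have : (i + n) % 2 = 1 := by omega
              simp [hn, this]
            · have : (i + n) % 2 = 0 := by omega
              simp [hn, this]
          rw [e] at ax ay
          simp only [← add_assoc, ax, ay]; ring
        · simp
        · simp only [det]; norm_num
        · simp only [det, add_zero]; linarith
    intro i j ex ey
    rcases lt_trichotomy i j with hl | hl | hl
    · obtain ⟨k, rfl⟩ := Nat.exists_eq_add_of_lt hl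
      have := key i k
      rw [← add_assoc, ← ex, ← ey] at this
      linarith
    · exact hl
    · obtain ⟨k, rfl⟩ := Nat.exists_eq_add_of_lt hl
      have := key j k
      rw [← add_assoc, ex, ey] at this
      linarith

def auxU (b c : ℤ) (m : ℕ) : ℤ × ℤ := w1 b c m (if m % 2 = 0 then (1, 0) else (0, 1))

lemma w1_lin (b c : ℤ) (m : ℕ) : ∀ (k : ℤ) (u v : ℤ × ℤ),
    w1 b c m (k • u - v) = k • w1 b c m u - w1 b c m v := by
  induction m with
  | zero => intro k u v; rfl
  | succ m ih =>
    intro k u v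
    simp only [w1, Function.comp]
    rw [← ih]
    congr 1
    split_ifs <;> ext <;> simp [refl1, refl2] <;> ring

lemma auxU_rec (b c : ℤ) (m : ℕ) :
    auxU b c (m + 2) = (if m % 2 = 0 then c else b) • auxU b c (m + 1) - auxU b c m := by
  unfold auxU
  simp only [w1, Function.comp]
  rw [← w1_lin]
  congr 1
  rcases Nat.mod_two_eq_zero_or_one m with hm | hm
  · have : (m + 1) % 2 = 1 := by omega
    simp [hm, this, refl1, refl2]; ring
  · have : (m + 1) % 2 = 0 := by omega
    simp [hm, this, refl1, refl2]; ring

lemma w2_swap (b c : ℤ) (m : ℕ) : ∀ v : ℤ × ℤ, w2 b c m v = (w1 c b m v.swap).swap := by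
  induction m with
  | zero => intro v; rfl
  | succ m ih =>
    intro v
    simp only [w1, w2, Function.comp]
    rw [ih]
    congr 2
    split_ifs <;> simp [refl1, refl2] <;> ring

lemma auxU_facts (p q : ℤ) (hp : 0 < p) (hq : 0 < q) (h : 4 ≤ p * q) :
    (∀ n, 0 ≤ (auxU p q n).1 ∧ 0 ≤ (auxU p q n).2 ∧
      p * (auxU p q n).2 < 2 * (auxU p q n).1) ∧ Function.Injective (auxU p q) := by
  have := aux_seq p q hp hq h (fun n => (auxU p q n).1) (fun n => (auxU p q n).2)
    (by intro n; rw [auxU_rec]; rfl) (by intro n; rw [auxU_rec]; rfl)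
    (by simp [auxU, w1]) (by simp [auxU, w1, refl1]) (by simp [auxU, w1])
    (by simp [auxU, w1, refl1])
  exact ⟨this.1, fun i j hij => this.2 i j (by simp [hij]) (by simp [hij])⟩

lemma vecPosPart_eq (v : ℤ × ℤ) (h1 : 0 ≤ v.1) (h2 : 0 ≤ v.2) : vecPosPart v = v := by
  simp [vecPosPart, h1, h2]

/-- In the infinite case `bc ≥ 4`: `δ(m+3) = w₁(m) α_{⟨m+1⟩}` and
`δ(−m) = w₂(m) α_{⟨m+2⟩}` for all `m ≥ 0`; in particular `δ` is injective.
Here `α₁ = (1,0)`, `α₂ = (0,1)`, and `α_{⟨m+1⟩} = α₁` iff `m` is even,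
`α_{⟨m+2⟩} = α₁` iff `m` is odd. -/
theorem denominators_rank_two_infinite_case
    (b c : ℕ) (hbc : (0 < b ∧ 0 < c) ∨ (b = 0 ∧ c = 0)) (h4 : 4 ≤ b * c)
    (δ : ℤ → ℤ × ℤ)
    (hδ1 : δ 1 = (-1, 0)) (hδ2 : δ 2 = (0, -1))
    (hodd : ∀ m : ℤ, Odd m → δ (m + 1) + δ (m - 1) = (b : ℤ) • vecPosPart (δ m))
    (heven : ∀ m : ℤ, Even m → δ (m + 1) + δ (m - 1) = (c : ℤ) • vecPosPart (δ m)) :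
    (∀ m : ℕ,
        δ ((m : ℤ) + 3) = w1 (b : ℤ) (c : ℤ) m (if m % 2 = 0 then ((1 : ℤ), (0 : ℤ)) else (0, 1)) ∧
        δ (-(m : ℤ)) = w2 (b : ℤ) (c : ℤ) m (if m % 2 = 1 then ((1 : ℤ), (0 : ℤ)) else (0, 1))) ∧
      Function.Injective δ := by
  have hb : (0 : ℤ) < b := by
    rcases hbc with h | h
    · exact_mod_cast h.1
    · simp [h.1] at h4
  have hc : (0 : ℤ) < c := by
    rcases hbc with h | h
    · exact_mod_cast h.2
    · simp [h.1] at h4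
  have h4' : (4 : ℤ) ≤ b * c := by exact_mod_cast h4
  obtain ⟨P, Pinj⟩ := auxU_facts b c hb hc h4'
  obtain ⟨N, Ninj⟩ := auxU_facts c b hc hb (by linarith)
  have pos : ∀ m : ℕ, δ ((m : ℤ) + 3) = auxU b c m ∧ δ ((m : ℤ) + 4) = auxU b c (m + 1) := by
    intro m
    induction m with
    | zero =>
      have a := heven 2 (by decide)
      have d := hodd 3 (by decide)
      norm_num [hδ1, hδ2, vecPosPart] at a d
      have a' : δ 3 = (1, 0) := by
        rw [eq_sub_of_add_eq a]; simp
      rw [a'] at d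
      have d' : δ 4 = ((b : ℤ), 1) := by
        rw [eq_sub_of_add_eq d]; simp
      simp [a', d', auxU, w1, refl1]
    | succ m ih =>
      have e1 : ((m + 1 : ℕ) : ℤ) + 3 = m + 4 := by push_cast; ring
      have e2 : ((m + 1 : ℕ) : ℤ) + 4 = (m + 4 : ℤ) + 1 := by push_cast; ring
      have e3 : (m : ℤ) + 3 = (m + 4 : ℤ) - 1 := by ring
      refine ⟨by rw [e1]; exact ih.2, ?_⟩
      rw [e2, auxU_rec, ← ih.1, ← ih.2, e3]
      have hv : vecPosPart (δ (m + 4)) = δ (m + 4) := by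
        rw [ih.2]; exact vecPosPart_eq _ (P _).1 (P _).2.1
      rcases Nat.mod_two_eq_zero_or_one m with hm | hm
      · have := heven (m + 4) (by rw [Int.even_iff]; omega)
        rw [hv] at this
        rw [if_pos hm]; exact eq_sub_of_add_eq this
      · have := hodd (m + 4) (by rw [Int.odd_iff]; omega)
        rw [hv] at this
        rw [if_neg (by omega)]; exact eq_sub_of_add_eq this
  have neg : ∀ m : ℕ, δ (-(m : ℤ)) = (auxU c b m).swap ∧
      δ (-(m : ℤ) - 1) = (auxU c b (m + 1)).swap := by
    intro m
    induction m with
    | zero =>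
      have a := hodd 1 (by decide)
      have d := heven 0 (by decide)
      norm_num [hδ1, hδ2, vecPosPart] at a d
      have a' : δ 0 = (0, 1) := by
        rw [eq_sub_of_add_eq' a]; simp
      rw [a'] at d
      have d' : δ (-1) = (1, (c : ℤ)) := by
        rw [eq_sub_of_add_eq' d]; simp
      simp [a', d', auxU, w1, refl1]
    | succ m ih =>
      have e1 : -((m + 1 : ℕ) : ℤ) = -m - 1 := by push_cast; ring
      have e3 : δ (-(m : ℤ)) = δ ((-m - 1 : ℤ) + 1) := by congr 1; ring
      refine ⟨by rw [e1]; exact ih.2, ?_⟩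
      have sw : ∀ (k : ℤ) (u v : ℤ × ℤ), (k • u - v).swap = k • u.swap - v.swap := by
        intro k u v; rfl
      rw [e1, auxU_rec, sw, ← ih.1, ← ih.2, e3]
      have hv : vecPosPart (δ (-m - 1)) = δ (-m - 1) := by
        rw [ih.2]; exact vecPosPart_eq _ (N (m + 1)).2.1 (N (m + 1)).1
      rcases Nat.mod_two_eq_zero_or_one m with hm | hm
      · have := hodd (-m - 1) (by rw [Int.odd_iff]; omega)
        rw [hv] at this
        rw [if_pos hm]; exact eq_sub_of_add_eq' this
      · have := heven (-m - 1) (by rw [Int.even_iff]; omega)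
        rw [hv] at this
        rw [if_neg (by omega)]; exact eq_sub_of_add_eq' this
  refine ⟨fun m => ⟨(pos m).1, ?_⟩, ?_⟩
  · rw [(neg m).1, w2_swap, auxU]
    congr 2
    rcases Nat.mod_two_eq_zero_or_one m with hm | hm <;> simp [hm]
  · have cls : ∀ k : ℤ, k = 1 ∨ k = 2 ∨ (∃ m : ℕ, k = m + 3) ∨ (∃ m : ℕ, k = -m) := by
      intro k
      by_cases h3 : 3 ≤ k
      · exact Or.inr (Or.inr (Or.inl ⟨(k - 3).toNat, by omega⟩))
      by_cases h0 : k ≤ 0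
      · exact Or.inr (Or.inr (Or.inr ⟨(-k).toNat, by omega⟩))
      omega
    have cross : ∀ m n : ℕ, auxU b c m ≠ (auxU c b n).swap := by
      intro m n e
      obtain ⟨p1, p2, p3⟩ := P m
      obtain ⟨n1, n2, n3⟩ := N n
      have e1 : (auxU b c m).1 = (auxU c b n).2 := by rw [e]; rfl
      have e2 : (auxU b c m).2 = (auxU c b n).1 := by rw [e]; rfl
      rw [← e1, ← e2] at n3
      generalize (auxU b c m).1 = x at *
      generalize (auxU b c m).2 = y at *
      have q1 : (c : ℤ) * (b * y) ≤ c * (2 * x) := mul_le_mul_of_nonneg_left p3.le hc.le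
      have q2 : 4 * y ≤ (b * c : ℤ) * y := mul_le_mul_of_nonneg_right h4' p2
      nlinarith
    intro i j hij
    rcases cls i with rfl | rfl | ⟨m, rfl⟩ | ⟨m, rfl⟩ <;>
    rcases cls j with rfl | rfl | ⟨n, rfl⟩ | ⟨n, rfl⟩ <;>
    simp only [hδ1, hδ2, (pos _).1, (neg _).1] at hij
    all_goals first
      | rfl
      | (exfalso; simp at hij; done)
      | (exfalso; exact cross _ _ hij)
      | (exfalso; exact cross _ _ hij.symm)
      | (rw [Pinj hij])
      | (rw [Ninj (Prod.swap_injective hij)])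
      | (exfalso
         have h1 := congrArg Prod.fst hij
         have h2 := congrArg Prod.snd hij
         simp only [Prod.fst_swap, Prod.snd_swap] at h1 h2
         first
           | (have := P m; omega)
           | (have := P n; omega)
           | (have := N m; omega)
           | (have := N n; omega))
end

section
/- Suppose bc ≤ 3 and let h be the Coxeter number (h = 2 if bc = 0, h = 3 if bc = 1, h = 4 if bc = 2, h = 6 if bc = 3). Then δ(m+3) = w1(m) α_{⟨m+1⟩} for all 0 ≤ m < h, and δ is periodic with period h+2, i.e., δ(m+h+2) = δ(m) for all m ∈ ℤ. Consequently the set of values {δ(m) : m ∈ ℤ} equals {−α1, −α2} ∪ {w1(m) α_{⟨m+1⟩} : 0 ≤ m < h}. -/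
theorem aux_per (k : ℤ → ℤ) (δ : ℤ → ℤ × ℤ) (P : ℤ)
    (hk : ∀ m, k (m + P) = k m)
    (hr : ∀ m : ℤ, δ (m + 1) + δ (m - 1) = k m • vecPosPart (δ m))
    (h1 : δ (1 + P) = δ 1) (h2 : δ (2 + P) = δ 2) (m : ℤ) : δ (m + P) = δ m := by
  have key : ∀ n : ℤ, δ (n + 1 + P) = δ (n + 1) ∧ δ (n + 2 + P) = δ (n + 2) := by
    intro n
    induction n using Int.induction_on with
    | zero => exact ⟨by simpa using h1, by simpa using h2⟩
    | succ i ih =>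
      obtain ⟨ha, hb⟩ := ih
      refine ⟨by rw [show (i : ℤ) + 1 + 1 = i + 2 by ring]; exact hb, ?_⟩
      have e1 := hr (i + 2 + P)
      have e2 := hr (i + 2)
      rw [hk, hb, ← e2, show (i : ℤ) + 2 + P - 1 = i + 1 + P by ring,
        show (i : ℤ) + 2 - 1 = i + 1 by ring, ha] at e1
      have e3 := add_right_cancel e1
      rw [show (i : ℤ) + 1 + 2 + P = i + 2 + P + 1 by ring, e3]
      congr 1
    | pred i ih =>
      obtain ⟨ha, hb⟩ := ih
      refine ⟨?_, by rw [show -(i : ℤ) - 1 + 2 = -i + 1 by ring]; exact ha⟩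
      have e1 := hr (-i + 1 + P)
      have e2 := hr (-i + 1)
      rw [hk, ha, ← e2, show -(i : ℤ) + 1 + P + 1 = -i + 2 + P by ring,
        show -(i : ℤ) + 1 + 1 = -i + 2 by ring, hb] at e1
      have e3 := add_left_cancel e1
      rw [show -(i : ℤ) - 1 + 1 + P = -i + 1 + P - 1 by ring, e3]
      congr 1; ring
  have := (key (m - 1)).1
  simpa using this

theorem aux_range (δ : ℤ → ℤ × ℤ) (h : ℕ) (g : ℕ → ℤ × ℤ)
    (hδ1 : δ 1 = (-1, 0)) (hδ2 : δ 2 = (0, -1))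
    (hg : ∀ m : ℕ, m < h → δ ((m : ℤ) + 3) = g m)
    (hp : ∀ m : ℤ, δ (m + h + 2) = δ m) :
    Set.range δ = ({(-1, 0), (0, -1)} : Set (ℤ × ℤ)) ∪
        {v : ℤ × ℤ | ∃ m : ℕ, m < h ∧ v = g m} := by
  ext v
  constructor
  · rintro ⟨m, rfl⟩
    have hper : Function.Periodic δ ((h : ℤ) + 2) := fun x => by rw [← add_assoc]; exact hp x
    have e : δ m = δ (1 + (m - 1) % ((h : ℤ) + 2)) := by
      have := hper.int_mul ((m - 1) / ((h : ℤ) + 2)) (1 + (m - 1) % ((h : ℤ) + 2))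
      rw [← this]
      congr 1
      have := Int.emod_add_mul_ediv (m - 1) ((h : ℤ) + 2)
      push_cast
      linarith
    have r0 := Int.emod_nonneg (m - 1) (show ((h : ℤ) + 2) ≠ 0 by omega)
    have r1 := Int.emod_lt_of_pos (m - 1) (show 0 < ((h : ℤ) + 2) by omega)
    rw [e]
    generalize (m - 1) % ((h : ℤ) + 2) = r at r0 r1
    obtain rfl | rfl | hr : r = 0 ∨ r = 1 ∨ 2 ≤ r := by omega
    · left; left; simpa using hδ1
    · left; right; simpa using hδ2
    · right
      refine ⟨(r - 2).toNat, by omega, ?_⟩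
      rw [← hg _ (by omega)]
      congr 1
      omega
  · rintro ((rfl | rfl) | ⟨m, hm, rfl⟩)
    · exact ⟨1, hδ1⟩
    · exact ⟨2, hδ2⟩
    · exact ⟨_, hg m hm⟩

/-- In the finite case `bc ≤ 3`, with `h` the Coxeter number:
`δ(m+3) = w₁(m) α_{⟨m+1⟩}` for `0 ≤ m < h`, the sequence `δ` is periodic with
period `h + 2`, and the set of values of `δ` is
`{-α₁, -α₂} ∪ {w₁(m) α_{⟨m+1⟩} : 0 ≤ m < h}`.
Here `α₁ = (1,0)`, `α₂ = (0,1)`, and `α_{⟨m+1⟩} = α₁` iff `m` is even. -/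
theorem denominators_rank_two_finite_case
    (b c : ℕ) (hbc : (0 < b ∧ 0 < c) ∨ (b = 0 ∧ c = 0)) (hfin : b * c ≤ 3)
    (h : ℕ)
    (hh : h = if b * c = 0 then 2 else if b * c = 1 then 3 else if b * c = 2 then 4 else 6)
    (δ : ℤ → ℤ × ℤ)
    (hδ1 : δ 1 = (-1, 0)) (hδ2 : δ 2 = (0, -1))
    (hodd : ∀ m : ℤ, Odd m → δ (m + 1) + δ (m - 1) = (b : ℤ) • vecPosPart (δ m))
    (heven : ∀ m : ℤ, Even m → δ (m + 1) + δ (m - 1) = (c : ℤ) • vecPosPart (δ m)) :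
    (∀ m : ℕ, m < h →
        δ ((m : ℤ) + 3) =
          w1 (b : ℤ) (c : ℤ) m (if m % 2 = 0 then ((1 : ℤ), (0 : ℤ)) else (0, 1))) ∧
    (∀ m : ℤ, δ (m + h + 2) = δ m) ∧
    Set.range δ =
      ({(-1, 0), (0, -1)} : Set (ℤ × ℤ)) ∪
        {v : ℤ × ℤ | ∃ m : ℕ, m < h ∧
          v = w1 (b : ℤ) (c : ℤ) m (if m % 2 = 0 then ((1 : ℤ), (0 : ℤ)) else (0, 1))} := by
  have r3 := heven 2 (by decide)
  have r4 := hodd 3 (by decide)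
  have r5 := heven 4 (by decide)
  have r6 := hodd 5 (by decide)
  have r7 := heven 6 (by decide)
  have r8 := hodd 7 (by decide)
  have r9 := heven 8 (by decide)
  have r10 := hodd 9 (by decide)
  norm_num at r3 r4 r5 r6 r7 r8 r9 r10
  have hr : ∀ m : ℤ, δ (m + 1) + δ (m - 1) =
      (if Even m then (c : ℤ) else b) • vecPosPart (δ m) := by
    intro m
    split_ifs with hm
    · exact heven m hm
    · exact hodd m (Int.not_even_iff_odd.mp hm)
  have main : (∀ m : ℕ, m < h → δ ((m : ℤ) + 3) =
          w1 (b : ℤ) (c : ℤ) m (if m % 2 = 0 then ((1 : ℤ), (0 : ℤ)) else (0, 1))) ∧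
      (∀ m : ℤ, δ (m + h + 2) = δ m) := by
    have hcases : (b = 0 ∧ c = 0) ∨ (b = 1 ∧ c = 1) ∨ (b = 1 ∧ c = 2) ∨ (b = 2 ∧ c = 1) ∨
        (b = 1 ∧ c = 3) ∨ (b = 3 ∧ c = 1) := by
      rcases hbc with ⟨h1, h2⟩ | h0
      · have : b ≤ 3 := by nlinarith
        have : c ≤ 3 := by nlinarith
        interval_cases b <;> interval_cases c <;> simp_all
      · exact Or.inl h0
    clear hodd heven
    rcases hcases with ⟨rfl, rfl⟩ | ⟨rfl, rfl⟩ | ⟨rfl, rfl⟩ | ⟨rfl, rfl⟩ | ⟨rfl, rfl⟩ | ⟨rfl, rfl⟩ <;>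
    norm_num at hh <;> subst hh <;>
    (rw [hδ2, hδ1, ← eq_sub_iff_add_eq] at r3
     norm_num [vecPosPart] at r3
     rw [r3, hδ2, ← eq_sub_iff_add_eq] at r4
     norm_num [vecPosPart] at r4
     rw [r4, r3, ← eq_sub_iff_add_eq] at r5
     norm_num [vecPosPart] at r5
     rw [r5, r4, ← eq_sub_iff_add_eq] at r6
     norm_num [vecPosPart] at r6
     rw [r6, r5, ← eq_sub_iff_add_eq] at r7
     norm_num [vecPosPart] at r7
     rw [r7, r6, ← eq_sub_iff_add_eq] at r8
     norm_num [vecPosPart] at r8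
     rw [r8, r7, ← eq_sub_iff_add_eq] at r9
     norm_num [vecPosPart] at r9
     rw [r9, r8, ← eq_sub_iff_add_eq] at r10
     norm_num [vecPosPart] at r10
     constructor
     · intro m hm
       interval_cases m <;> norm_num [w1, refl1, refl2, *] <;> rfl
     · intro m
       rw [add_assoc]
       refine aux_per _ δ _ ?_ hr ?_ ?_ m
       · intro m
         norm_num [Int.even_add, show Even (6 : ℤ) by decide, show Even (8 : ℤ) by decide, show Even (4 : ℤ) by decide]
       · norm_num [*] <;> rfl
       · norm_num [*] <;> rfl)
  exact ⟨main.1, main.2, aux_range δ h _ hδ1 hδ2 main.1 main.2⟩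
end

section
/- The sequence (u_m) is periodic with period h+2: u_{m+h+2} = u_m for all m ∈ ℤ. (In particular, the normalized coefficients q_m = u_m/(1+u_m) and r_m = 1/(1+u_m) satisfy q_{m+h+2} = q_m and r_{m+h+2} = r_m.) -/
theorem cpr_step {x y e E : ℝ} (hx : 0 < x) (h : y * x = e) (hE : E * x = e) : y = E :=
  mul_right_cancel₀ hx.ne' (h.trans hE.symm)

/-- Exponent `p` at odd and `q` at even indices. -/
def CprRel (p q : ℕ) (v : ℤ → ℝ) : Prop :=
  (∀ m, 0 < v m) ∧ (∀ m, Odd m → v (m + 1) * v (m - 1) = (1 + v m) ^ p) ∧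
    (∀ m, Even m → v (m + 1) * v (m - 1) = (1 + v m) ^ q)

theorem CprRel.shift {p q : ℕ} {v : ℤ → ℝ} (H : CprRel p q v) :
    CprRel q p (fun n => v (n + 1)) := by
  obtain ⟨h0, h1, h2⟩ := H
  refine ⟨fun m => h0 _, fun m hm => ?_, fun m hm => ?_⟩
  · have := h2 (m + 1) hm.add_one
    simpa [show m + 1 - 1 = m - 1 + 1 by ring] using this
  · have := h1 (m + 1) hm.add_one
    simpa [show m + 1 - 1 = m - 1 + 1 by ring] using this

theorem cpr_glue {v : ℤ → ℝ} (N : ℤ)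
    (H : ∀ m, Even m → v (m + N) = v m ∧ v (m + 1 + N) = v (m + 1)) (m : ℤ) :
    v (m + N) = v m := by
  rcases Int.even_or_odd m with hm | hm
  · exact (H m hm).1
  · have := (H (m - 1) (by simpa using hm.sub_odd odd_one)).2
    simpa using this

theorem cpr_one {v : ℤ → ℝ} (H : CprRel 1 1 v) (m : ℤ) : v (m + 5) = v m := by
  refine cpr_glue 5 (fun m hm => ?_) m
  obtain ⟨h0, h1, h2⟩ := H
  have e1 : v (m + 2) * v (m + 0) = (1 + v (m + 1)) ^ 1 := by
    have := h1 (m + 1) (by exact hm.add_odd (by decide))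
    rwa [show m + 1 + 1 = m + 2 by ring, show m + 1 - 1 = m + 0 by ring] at this
  have e2 : v (m + 3) * v (m + 1) = (1 + v (m + 2)) ^ 1 := by
    have := h2 (m + 2) (by exact hm.add (by decide))
    rwa [show m + 2 + 1 = m + 3 by ring, show m + 2 - 1 = m + 1 by ring] at this
  have e3 : v (m + 4) * v (m + 2) = (1 + v (m + 3)) ^ 1 := by
    have := h1 (m + 3) (by exact hm.add_odd (by decide))
    rwa [show m + 3 + 1 = m + 4 by ring, show m + 3 - 1 = m + 2 by ring] at this
  have e4 : v (m + 5) * v (m + 3) = (1 + v (m + 4)) ^ 1 := by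
    have := h2 (m + 4) (by exact hm.add (by decide))
    rwa [show m + 4 + 1 = m + 5 by ring, show m + 4 - 1 = m + 3 by ring] at this
  have e5 : v (m + 6) * v (m + 4) = (1 + v (m + 5)) ^ 1 := by
    have := h1 (m + 5) (by exact hm.add_odd (by decide))
    rwa [show m + 5 + 1 = m + 6 by ring, show m + 5 - 1 = m + 4 by ring] at this
  have ha := h0 (m + 0)
  have hb := h0 (m + 1)
  have p2 := h0 (m + 2)
  have p3 := h0 (m + 3)
  have p4 := h0 (m + 4)
  have p5 := h0 (m + 5)
  have p6 := h0 (m + 6)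
  rw [add_assoc m 1, show (1 : ℤ) + 5 = 6 by norm_num]
  suffices hs : v (m + 5) = v (m + 0) ∧ v (m + 6) = v (m + 1) by simpa using hs
  generalize v (m + 0) = a at *
  generalize v (m + 1) = b at *
  generalize v (m + 2) = x2 at *
  generalize v (m + 3) = x3 at *
  generalize v (m + 4) = x4 at *
  generalize v (m + 5) = x5 at *
  generalize v (m + 6) = x6 at *
  clear h0 h1 h2
  have f2 : x2 = (1+b)/a := by
    refine cpr_step ha e1 ?_
    field_simp
    try ring
  have f3 : x3 = (a+b+1)/(a*b) := by
    refine cpr_step hb e2 ?_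
    rw [f2]
    field_simp
    try ring
  have f4 : x4 = (a+1)/b := by
    refine cpr_step p2 e3 ?_
    rw [f2, f3]
    field_simp
    try ring
  have f5 : x5 = a := by
    refine cpr_step p3 e4 ?_
    rw [f3, f4]
    field_simp
    try ring
  have f6 : x6 = b := by
    refine cpr_step p4 e5 ?_
    rw [f4, f5]
    field_simp
    try ring
  exact ⟨f5, f6⟩

theorem cpr_two {v : ℤ → ℝ} (H : CprRel 1 2 v) (m : ℤ) : v (m + 6) = v m := by
  refine cpr_glue 6 (fun m hm => ?_) m
  obtain ⟨h0, h1, h2⟩ := H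
  have e1 : v (m + 2) * v (m + 0) = (1 + v (m + 1)) ^ 1 := by
    have := h1 (m + 1) (by exact hm.add_odd (by decide))
    rwa [show m + 1 + 1 = m + 2 by ring, show m + 1 - 1 = m + 0 by ring] at this
  have e2 : v (m + 3) * v (m + 1) = (1 + v (m + 2)) ^ 2 := by
    have := h2 (m + 2) (by exact hm.add (by decide))
    rwa [show m + 2 + 1 = m + 3 by ring, show m + 2 - 1 = m + 1 by ring] at this
  have e3 : v (m + 4) * v (m + 2) = (1 + v (m + 3)) ^ 1 := by
    have := h1 (m + 3) (by exact hm.add_odd (by decide))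
    rwa [show m + 3 + 1 = m + 4 by ring, show m + 3 - 1 = m + 2 by ring] at this
  have e4 : v (m + 5) * v (m + 3) = (1 + v (m + 4)) ^ 2 := by
    have := h2 (m + 4) (by exact hm.add (by decide))
    rwa [show m + 4 + 1 = m + 5 by ring, show m + 4 - 1 = m + 3 by ring] at this
  have e5 : v (m + 6) * v (m + 4) = (1 + v (m + 5)) ^ 1 := by
    have := h1 (m + 5) (by exact hm.add_odd (by decide))
    rwa [show m + 5 + 1 = m + 6 by ring, show m + 5 - 1 = m + 4 by ring] at this
  have e6 : v (m + 7) * v (m + 5) = (1 + v (m + 6)) ^ 2 := by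
    have := h2 (m + 6) (by exact hm.add (by decide))
    rwa [show m + 6 + 1 = m + 7 by ring, show m + 6 - 1 = m + 5 by ring] at this
  have ha := h0 (m + 0)
  have hb := h0 (m + 1)
  have p2 := h0 (m + 2)
  have p3 := h0 (m + 3)
  have p4 := h0 (m + 4)
  have p5 := h0 (m + 5)
  have p6 := h0 (m + 6)
  have p7 := h0 (m + 7)
  rw [add_assoc m 1, show (1 : ℤ) + 6 = 7 by norm_num]
  suffices hs : v (m + 6) = v (m + 0) ∧ v (m + 7) = v (m + 1) by simpa using hs
  generalize v (m + 0) = a at *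
  generalize v (m + 1) = b at *
  generalize v (m + 2) = x2 at *
  generalize v (m + 3) = x3 at *
  generalize v (m + 4) = x4 at *
  generalize v (m + 5) = x5 at *
  generalize v (m + 6) = x6 at *
  generalize v (m + 7) = x7 at *
  clear h0 h1 h2
  have f2 : x2 = (1+b)/a := by
    refine cpr_step ha e1 ?_
    field_simp
    try ring
  have f3 : x3 = (a+b+1)^2/(a^2*b) := by
    refine cpr_step hb e2 ?_
    rw [f2]
    field_simp
    try ring
  have f4 : x4 = ((a+1)^2+b)/(a*b) := by
    refine cpr_step p2 e3 ?_
    rw [f2, f3]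
    field_simp
    try ring
  have f5 : x5 = (a+1)^2/b := by
    refine cpr_step p3 e4 ?_
    rw [f3, f4]
    field_simp
    try ring
  have f6 : x6 = a := by
    refine cpr_step p4 e5 ?_
    rw [f4, f5]
    field_simp
    try ring
  have f7 : x7 = b := by
    refine cpr_step p5 e6 ?_
    rw [f5, f6]
    field_simp
    try ring
  exact ⟨f6, f7⟩

theorem cpr_three {v : ℤ → ℝ} (H : CprRel 1 3 v) (m : ℤ) : v (m + 8) = v m := by
  refine cpr_glue 8 (fun m hm => ?_) m
  obtain ⟨h0, h1, h2⟩ := H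
  have e1 : v (m + 2) * v (m + 0) = (1 + v (m + 1)) ^ 1 := by
    have := h1 (m + 1) (by exact hm.add_odd (by decide))
    rwa [show m + 1 + 1 = m + 2 by ring, show m + 1 - 1 = m + 0 by ring] at this
  have e2 : v (m + 3) * v (m + 1) = (1 + v (m + 2)) ^ 3 := by
    have := h2 (m + 2) (by exact hm.add (by decide))
    rwa [show m + 2 + 1 = m + 3 by ring, show m + 2 - 1 = m + 1 by ring] at this
  have e3 : v (m + 4) * v (m + 2) = (1 + v (m + 3)) ^ 1 := by
    have := h1 (m + 3) (by exact hm.add_odd (by decide))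
    rwa [show m + 3 + 1 = m + 4 by ring, show m + 3 - 1 = m + 2 by ring] at this
  have e4 : v (m + 5) * v (m + 3) = (1 + v (m + 4)) ^ 3 := by
    have := h2 (m + 4) (by exact hm.add (by decide))
    rwa [show m + 4 + 1 = m + 5 by ring, show m + 4 - 1 = m + 3 by ring] at this
  have e5 : v (m + 6) * v (m + 4) = (1 + v (m + 5)) ^ 1 := by
    have := h1 (m + 5) (by exact hm.add_odd (by decide))
    rwa [show m + 5 + 1 = m + 6 by ring, show m + 5 - 1 = m + 4 by ring] at this
  have e6 : v (m + 7) * v (m + 5) = (1 + v (m + 6)) ^ 3 := by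
    have := h2 (m + 6) (by exact hm.add (by decide))
    rwa [show m + 6 + 1 = m + 7 by ring, show m + 6 - 1 = m + 5 by ring] at this
  have e7 : v (m + 8) * v (m + 6) = (1 + v (m + 7)) ^ 1 := by
    have := h1 (m + 7) (by exact hm.add_odd (by decide))
    rwa [show m + 7 + 1 = m + 8 by ring, show m + 7 - 1 = m + 6 by ring] at this
  have e8 : v (m + 9) * v (m + 7) = (1 + v (m + 8)) ^ 3 := by
    have := h2 (m + 8) (by exact hm.add (by decide))
    rwa [show m + 8 + 1 = m + 9 by ring, show m + 8 - 1 = m + 7 by ring] at this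
  have ha := h0 (m + 0)
  have hb := h0 (m + 1)
  have p2 := h0 (m + 2)
  have p3 := h0 (m + 3)
  have p4 := h0 (m + 4)
  have p5 := h0 (m + 5)
  have p6 := h0 (m + 6)
  have p7 := h0 (m + 7)
  have p8 := h0 (m + 8)
  have p9 := h0 (m + 9)
  rw [add_assoc m 1, show (1 : ℤ) + 8 = 9 by norm_num]
  suffices hs : v (m + 8) = v (m + 0) ∧ v (m + 9) = v (m + 1) by simpa using hs
  generalize v (m + 0) = a at *
  generalize v (m + 1) = b at *
  generalize v (m + 2) = x2 at *
  generalize v (m + 3) = x3 at *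
  generalize v (m + 4) = x4 at *
  generalize v (m + 5) = x5 at *
  generalize v (m + 6) = x6 at *
  generalize v (m + 7) = x7 at *
  generalize v (m + 8) = x8 at *
  generalize v (m + 9) = x9 at *
  clear h0 h1 h2
  have f2 : x2 = (1+b)/a := by
    refine cpr_step ha e1 ?_
    field_simp
    try ring
  have f3 : x3 = (a+b+1)^3/(a^3*b) := by
    refine cpr_step hb e2 ?_
    rw [f2]
    field_simp
    try ring
  have f4 : x4 = (a^3+3*a^2+3*a*(b+1)+(b+1)^2)/(a^2*b) := by
    refine cpr_step p2 e3 ?_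
    rw [f2, f3]
    field_simp
    try ring
  have f5 : x5 = (a^2+2*a+b+1)^3/(a^3*b^2) := by
    refine cpr_step p3 e4 ?_
    rw [f3, f4]
    field_simp
    try ring
  have f6 : x6 = (b+(1+a)^3)/(a*b) := by
    refine cpr_step p4 e5 ?_
    rw [f4, f5]
    field_simp
    try ring
  have f7 : x7 = (1+a)^3/b := by
    refine cpr_step p5 e6 ?_
    rw [f5, f6]
    field_simp
    try ring
  have f8 : x8 = a := by
    refine cpr_step p6 e7 ?_
    rw [f6, f7]
    field_simp
    try ring
  have f9 : x9 = b := by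
    refine cpr_step p7 e8 ?_
    rw [f7, f8]
    field_simp
    try ring
  exact ⟨f8, f9⟩

/-- **Periodicity of normalized coefficients in rank 2 (finite case).**
If `bc ≤ 3` and `h` is the corresponding Coxeter number, then any sequence of
positive reals satisfying `u_{m+1} u_{m−1} = (1 + u_m)^c` for odd `m` and
`u_{m+1} u_{m−1} = (1 + u_m)^b` for even `m` is periodic with period `h + 2`;
in particular the normalized coefficients `q_m = u_m/(1+u_m)` and
`r_m = 1/(1+u_m)` are periodic with period `h + 2`. -/
theorem coefficient_periodicity_rank_two
    (b c : ℕ) (hbc : (0 < b ∧ 0 < c) ∨ (b = 0 ∧ c = 0)) (hfin : b * c ≤ 3)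
    (h : ℕ)
    (hh : h = if b * c = 0 then 2 else if b * c = 1 then 3 else if b * c = 2 then 4 else 6)
    (u : ℤ → ℝ) (hpos : ∀ m : ℤ, 0 < u m)
    (hodd : ∀ m : ℤ, Odd m → u (m + 1) * u (m - 1) = (1 + u m) ^ c)
    (heven : ∀ m : ℤ, Even m → u (m + 1) * u (m - 1) = (1 + u m) ^ b) :
    ∀ m : ℤ, u (m + h + 2) = u m ∧
      u (m + h + 2) / (1 + u (m + h + 2)) = u m / (1 + u m) ∧
      1 / (1 + u (m + h + 2)) = 1 / (1 + u m) := by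
  have H : CprRel c b u := ⟨hpos, hodd, heven⟩
  have key : ∀ m : ℤ, u (m + h + 2) = u m := by
    intro m
    have hb : b ≤ 3 := by
      rcases hbc with ⟨h1, h2⟩ | ⟨h1, h2⟩ <;> nlinarith
    have hc : c ≤ 3 := by
      rcases hbc with ⟨h1, h2⟩ | ⟨h1, h2⟩ <;> nlinarith
    clear hodd heven
    interval_cases b <;> interval_cases c <;> first | (exfalso; clear hh; omega) | (norm_num at hh; subst hh; push_cast)
    · have h1 := H.2.1
      have h2 := H.2.2
      have h3 : ∀ m, u (m + 1) * u (m - 1) = 1 := fun m => by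
        rcases Int.even_or_odd m with hm | hm
        · simpa using h2 m hm
        · simpa using h1 m hm
      have e1 := h3 (m + 1)
      have e2 := h3 (m + 3)
      rw [show m + 1 + 1 = m + 2 by ring, show m + 1 - 1 = m by ring] at e1
      rw [show m + 3 + 1 = m + 2 + 2 by ring, show m + 3 - 1 = m + 2 by ring] at e2
      exact cpr_step (hpos (m + 2)) e2 (by rw [mul_comm]; exact e1)
    · rw [add_assoc]; exact cpr_one H m
    · have := cpr_two H.shift (m - 1)
      simp only [show m - 1 + 6 + 1 = m + 4 + 2 by ring, show m - 1 + 1 = m by ring] at this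
      exact this
    · have := cpr_three H.shift (m - 1)
      simp only [show m - 1 + 8 + 1 = m + 6 + 2 by ring, show m - 1 + 1 = m by ring] at this
      exact this
    · rw [add_assoc]; exact cpr_two H m
    · rw [add_assoc]; exact cpr_three H m
  intro m
  rw [key m]
  exact ⟨rfl, rfl, rfl⟩
end

section
/- Suppose bc ≥ 4. Then all terms of the rank-2 cluster sequence with trivial coefficients are pairwise distinct: y_m ≠ y_{m'} whenever m ≠ m' in ℤ. -/
/-- `z` is regular at the real point `r`, with value `v`. -/
def RepAt (r : Fin 2 → ℝ) (z : ClusterField) (v : ℝ) : Prop :=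
  ∃ p q : MvPolynomial (Fin 2) ℤ,
    z * algebraMap _ ClusterField q = algebraMap _ ClusterField p ∧
    MvPolynomial.aeval r q ≠ 0 ∧ MvPolynomial.aeval r p = v * MvPolynomial.aeval r q

theorem RepAt.unique {r : Fin 2 → ℝ} {z : ClusterField} {v w : ℝ}
    (h1 : RepAt r z v) (h2 : RepAt r z w) : v = w := by
  obtain ⟨p, q, h, hq, hp⟩ := h1
  obtain ⟨p', q', h', hq', hp'⟩ := h2
  have e : p * q' = p' * q := by
    apply IsFractionRing.injective (MvPolynomial (Fin 2) ℤ) ClusterField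
    rw [map_mul, map_mul, ← h, ← h']
    ring
  have e2 := congrArg (MvPolynomial.aeval r) e
  rw [map_mul, map_mul, hp, hp'] at e2
  have : (v - w) * (MvPolynomial.aeval r q * MvPolynomial.aeval r q') = 0 := by
    linear_combination e2
  rcases mul_eq_zero.1 this with h | h
  · linarith
  · exact absurd h (mul_ne_zero hq hq')

theorem RepAt.pow_add_one {r : Fin 2 → ℝ} {z : ClusterField} {v : ℝ}
    (h1 : RepAt r z v) (n : ℕ) : RepAt r (z ^ n + 1) (v ^ n + 1) := by
  obtain ⟨p, q, h, hq, hp⟩ := h1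
  refine ⟨p ^ n + q ^ n, q ^ n, ?_, ?_, ?_⟩
  · rw [map_add, map_pow, map_pow, ← h]; ring
  · rw [map_pow]; exact pow_ne_zero _ hq
  · rw [map_add, map_pow, map_pow, hp]; ring

theorem RepAt.div {r : Fin 2 → ℝ} {z x u : ClusterField} {v w : ℝ}
    (h1 : RepAt r z v) (h2 : RepAt r u w) (hv : v ≠ 0) (hx : z * x = u) :
    RepAt r x (w / v) := by
  obtain ⟨p, q, h, hq, hp⟩ := h1
  obtain ⟨p', q', h', hq', hp'⟩ := h2
  refine ⟨p' * q, p * q', ?_, ?_, ?_⟩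
  · rw [map_mul, map_mul, ← h, ← h', ← hx]; ring
  · rw [map_mul, hp]; exact mul_ne_zero (mul_ne_zero hv hq) hq'
  · rw [map_mul, map_mul, hp, hp']; field_simp

theorem exists_point (e : ℤ → ℕ) (y : ℤ → ClusterField)
    (hy1 : y 1 = clusterVar 0) (hy2 : y 2 = clusterVar 1)
    (h : ∀ m : ℤ, y (m - 1) * y (m + 1) = y m ^ e m + 1) (k : ℤ) :
    ∀ s t : ℝ, 0 < s → 0 < t → ∃ r, RepAt r (y k) s ∧ RepAt r (y (k + 1)) t := by
  induction k using Int.inductionOn' (b := 1) with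
  | zero =>
    intro s t _ _
    refine ⟨![s, t], ⟨MvPolynomial.X 0, 1, ?_, ?_, ?_⟩, ⟨MvPolynomial.X 1, 1, ?_, ?_, ?_⟩⟩
    · rw [hy1]; simp [clusterVar]
    · simp
    · simp
    · rw [show (1 : ℤ) + 1 = 2 by norm_num, hy2]; simp [clusterVar]
    · simp
    · simp
  | succ k _ ih =>
    intro s t hs ht
    have hp : 0 < (s ^ e (k + 1) + 1) / t := by positivity
    obtain ⟨r, h1, h2⟩ := ih ((s ^ e (k + 1) + 1) / t) s hp hs
    refine ⟨r, h2, ?_⟩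
    have h3 := h (k + 1)
    rw [add_sub_cancel_right] at h3
    have h4 := h1.div (h2.pow_add_one (e (k + 1))) hp.ne' h3
    have h5 : (s ^ e (k + 1) + 1) / ((s ^ e (k + 1) + 1) / t) = t := by
      have : s ^ e (k + 1) + 1 ≠ 0 := by positivity
      field_simp
    rwa [h5] at h4
  | pred k _ ih =>
    intro s t hs ht
    have hp : 0 < (t ^ e k + 1) / s := by positivity
    obtain ⟨r, h1, h2⟩ := ih t ((t ^ e k + 1) / s) ht hp
    refine ⟨r, ?_, by rwa [sub_add_cancel]⟩
    have h3 := h k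
    rw [mul_comm] at h3
    have h4 := h2.div (h1.pow_add_one (e k)) hp.ne' h3
    have h5 : (t ^ e k + 1) / ((t ^ e k + 1) / s) = s := by
      have : t ^ e k + 1 ≠ 0 := by positivity
      field_simp
    rwa [h5] at h4

theorem ne_of_lt_aux (e : ℤ → ℕ) (he : ∀ m, e (m + 2) = e m) (h4 : ∀ m, 4 ≤ e m * e (m + 1))
    (y : ℤ → ClusterField)
    (hy1 : y 1 = clusterVar 0) (hy2 : y 2 = clusterVar 1)
    (h : ∀ m : ℤ, y (m - 1) * y (m + 1) = y m ^ e m + 1) (m : ℤ) (n : ℕ) :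
    y m ≠ y (m + n + 1) := by
  obtain ⟨r, h1, h2⟩ := exists_point e y hy1 hy2 h m 1 (Real.exp 1) one_pos (Real.exp_pos 1)
  have key : ∀ n : ℕ, ∃ v w : ℝ, 0 < v ∧ 0 < w ∧ RepAt r (y (m + n)) v ∧
      RepAt r (y (m + n + 1)) w ∧
      √(e (m + n)) * Real.log v ≤ √(e (m + n + 1)) * Real.log w ∧
      0 < √(e (m + n + 1)) * Real.log w := by
    intro n
    induction n with
    | zero =>
      have : 0 < e (m + 1) := by
        have := h4 m
        by_contra h0
        have h0 : e (m + 1) = 0 := by omega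
        simp [h0] at this
      have h0 : (0 : ℝ) < √(e (m + 1)) := Real.sqrt_pos.2 (by exact_mod_cast this)
      refine ⟨1, Real.exp 1, one_pos, Real.exp_pos 1, by simpa using h1, by simpa using h2, ?_, ?_⟩
      · simp
      · simpa using h0
    | succ n ih =>
      obtain ⟨v, w, hv, hw, rv, rw', hle, hpos⟩ := ih
      generalize hk : m + (n : ℤ) = k at *
      have hk' : m + ((n + 1 : ℕ) : ℤ) = k + 1 := by push_cast; linarith
      rw [hk', show k + 1 + 1 = k + 2 by ring, he]
      have h3 := h (k + 1)
      rw [add_sub_cancel_right, show k + 1 + 1 = k + 2 by ring] at h3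
      have hs : (2 : ℝ) ≤ √(e k) * √(e (k + 1)) := by
        rw [← Real.sqrt_mul (by positivity)]
        apply Real.le_sqrt_of_sq_le
        have := h4 k
        have : (4 : ℝ) ≤ e k * e (k + 1) := by exact_mod_cast this
        linarith
      have hsq : √(e (k + 1) : ℝ) * √(e (k + 1)) = e (k + 1) :=
        Real.mul_self_sqrt (by positivity)
      have hl : e (k + 1) * Real.log w - Real.log v ≤
          Real.log ((w ^ e (k + 1) + 1) / v) := by
        rw [Real.log_div (by positivity) hv.ne', ← Real.log_pow]
        have : Real.log (w ^ e (k + 1)) ≤ Real.log (w ^ e (k + 1) + 1) :=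
          Real.log_le_log (by positivity) (by linarith)
        linarith
      have hl2 := mul_le_mul_of_nonneg_left hl (Real.sqrt_nonneg (e k : ℝ))
      have hl3 := mul_le_mul_of_nonneg_right hs hpos.le
      have hge : √(e (k + 1)) * Real.log w ≤
          √(e k) * Real.log ((w ^ e (k + 1) + 1) / v) := by
        rw [← hsq] at hl2
        linarith
      exact ⟨w, (w ^ e (k + 1) + 1) / v, hw, by positivity, rw',
        rv.div (rw'.pow_add_one _) hv.ne' h3, hge, lt_of_lt_of_le hpos hge⟩
  intro heq
  obtain ⟨v, w, hv, hw, rv, rw', hle, hpos⟩ := key n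
  rw [← heq] at rw'
  have : w = 1 := rw'.unique h1
  simp [this] at hpos

/-- **Distinctness of cluster variables in rank 2 (infinite case).**
If `bc ≥ 4`, then all terms of the rank-2 cluster sequence with trivial
coefficients are pairwise distinct. -/
theorem cluster_variables_distinct_rank_two
    (b c : ℕ) (hbc : (0 < b ∧ 0 < c) ∨ (b = 0 ∧ c = 0)) (h4 : 4 ≤ b * c)
    (y : ℤ → ClusterField)
    (hy1 : y 1 = clusterVar 0) (hy2 : y 2 = clusterVar 1)
    (hodd : ∀ m : ℤ, Odd m → y (m - 1) * y (m + 1) = y m ^ b + 1)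
    (heven : ∀ m : ℤ, Even m → y (m - 1) * y (m + 1) = y m ^ c + 1) :
    ∀ m m' : ℤ, m ≠ m' → y m ≠ y m' := by
  classical
  have hA := ne_of_lt_aux (fun m => if Odd m then b else c)
    (by intro m; simp)
    (by
      intro m
      rcases Int.even_or_odd m with hm | hm
      · have h1 : ¬ Odd m := Int.not_odd_iff_even.2 hm
        have h2 : Odd (m + 1) := hm.add_one
        simp only [h1, h2, if_true, if_false]; linarith [mul_comm b c]
      · have h2 : ¬ Odd (m + 1) := Int.not_odd_iff_even.2 hm.add_one
        simp only [hm, h2, if_true, if_false]; exact h4)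
    y hy1 hy2
    (by
      intro m
      rcases Int.even_or_odd m with hm | hm
      · have h1 : ¬ Odd m := Int.not_odd_iff_even.2 hm
        simp only [h1, if_false]; exact heven m hm
      · simp only [hm, if_true]; exact hodd m hm)
  have hB : ∀ m m' : ℤ, m < m' → y m ≠ y m' := by
    intro m m' hlt
    have := hA m (m' - m - 1).toNat
    rwa [show m + ((m' - m - 1).toNat : ℤ) + 1 = m' by omega] at this
  intro m m' hne
  rcases lt_or_gt_of_ne hne with hlt | hlt
  · exact hB m m' hlt
  · exact (hB m' m hlt).symm
end

section
/- For every k ∈ ℤ, the coefficient r_k is expressed through the coefficients q_j by the dual-root formula r_k = ∏_{m=0}^{h−2} q_{k+m+2}^{c(⟨k+1⟩, m)}. -/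
/-- The dual simple reflection `s₁∨`, acting in the basis `(α₁∨, α₂∨)` of simple
coroots by the matrix `[[-1, c], [0, 1]]`. -/
def dualRefl1 (c : ℤ) (v : ℤ × ℤ) : ℤ × ℤ := (-v.1 + c * v.2, v.2)

/-- The dual simple reflection `s₂∨`, acting in the basis `(α₁∨, α₂∨)` by the
matrix `[[1, 0], [b, -1]]`. -/
def dualRefl2 (b : ℤ) (v : ℤ × ℤ) : ℤ × ℤ := (v.1, b * v.1 - v.2)

/-- `dualW1 b c m` is the alternating product `s₁∨ s₂∨ s₁∨ ⋯` of length `m`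
beginning with `s₁∨`. -/
def dualW1 (b c : ℤ) : ℕ → ℤ × ℤ → ℤ × ℤ
  | 0 => id
  | m + 1 => dualW1 b c m ∘ (if m % 2 = 0 then dualRefl1 c else dualRefl2 b)

/-- `dualW2 b c m` is the alternating product `s₂∨ s₁∨ s₂∨ ⋯` of length `m`
beginning with `s₂∨`. -/
def dualW2 (b c : ℤ) : ℕ → ℤ × ℤ → ℤ × ℤ
  | 0 => id
  | m + 1 => dualW2 b c m ∘ (if m % 2 = 0 then dualRefl2 b else dualRefl1 c)

/-- `dualRootCoef b c i m` is `c(i,m)`: the coefficient of `α_i∨` in the vector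
`w_i∨(m) α∨_{⟨i+m⟩}`, for `i ∈ {1,2}` and `m ≥ 0`.  Here `α₁∨ = (1,0)`,
`α₂∨ = (0,1)`, and `⟨i+m⟩ ∈ {1,2}` is congruent to `i + m` mod 2. -/
def dualRootCoef (b c : ℤ) (i : ℕ) (m : ℕ) : ℤ :=
  if i = 1 then
    (dualW1 b c m (if (1 + m) % 2 = 1 then ((1 : ℤ), (0 : ℤ)) else (0, 1))).1
  else
    (dualW2 b c m (if (2 + m) % 2 = 1 then ((1 : ℤ), (0 : ℤ)) else (0, 1))).2

lemma core2 (a0 a2 : ℝ) (h0 : 0 < a0) (h2 : 0 < a2)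
    (e1 : a2 * a0 = 1) : 1 / (1 + a0) = a2 / (1 + a2) := by
  field_simp
  linarith

lemma core3 (a0 a1 a2 a3 : ℝ) (h0 : 0 < a0) (h1 : 0 < a1) (h2 : 0 < a2) (h3 : 0 < a3)
    (e1 : a2 * a0 = 1 + a1) (e2 : a3 * a1 = 1 + a2) :
    1 / (1 + a0) = a2 / (1 + a2) * (a3 / (1 + a3)) := by
  obtain rfl : a1 = (1 + a2) / a3 := by field_simp; linarith
  obtain rfl : a0 = (1 + (1 + a2) / a3) / a2 := by field_simp at *; linarith
  field_simp
  ring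

lemma core4 (e f : ℕ) (hef : (e = 1 ∧ f = 2) ∨ (e = 2 ∧ f = 1)) (a0 a1 a2 a3 a4 : ℝ)
    (h0 : 0 < a0) (h1 : 0 < a1) (h2 : 0 < a2) (h3 : 0 < a3) (h4 : 0 < a4)
    (e1 : a2 * a0 = (1 + a1) ^ e) (e2 : a3 * a1 = (1 + a2) ^ f)
    (e3 : a4 * a2 = (1 + a3) ^ e) :
    1 / (1 + a0) = a2 / (1 + a2) * (a3 / (1 + a3)) ^ e * (a4 / (1 + a4)) := by
  obtain rfl : a4 = (1 + a3) ^ e / a2 := by rw [← e3]; field_simp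
  obtain rfl : a1 = (1 + a2) ^ f / a3 := by rw [← e2]; field_simp
  obtain rfl : a0 = (1 + (1 + a2) ^ f / a3) ^ e / a2 := by rw [← e1]; field_simp
  clear e1 e2 e3
  rcases hef with ⟨rfl, rfl⟩ | ⟨rfl, rfl⟩
  · field_simp
    ring
  · field_simp
    ring

lemma core6 (e f : ℕ) (hef : (e = 1 ∧ f = 3) ∨ (e = 3 ∧ f = 1)) (a0 a1 a2 a3 a4 a5 a6 : ℝ)
    (h0 : 0 < a0) (h1 : 0 < a1) (h2 : 0 < a2) (h3 : 0 < a3) (h4 : 0 < a4) (h5 : 0 < a5)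
    (h6 : 0 < a6)
    (e1 : a2 * a0 = (1 + a1) ^ e) (e2 : a3 * a1 = (1 + a2) ^ f)
    (e3 : a4 * a2 = (1 + a3) ^ e) (e4 : a5 * a3 = (1 + a4) ^ f)
    (e5 : a6 * a4 = (1 + a5) ^ e) :
    1 / (1 + a0) = a2 / (1 + a2) * (a3 / (1 + a3)) ^ e * (a4 / (1 + a4)) ^ 2
      * (a5 / (1 + a5)) ^ e * (a6 / (1 + a6)) := by
  have key : (1 + a2) * (1 + a6) = (1 + a0) * (1 + a4) := by
    obtain rfl : a5 = (1 + a4) ^ f / a3 := by rw [← e4]; field_simp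
    obtain rfl : a6 = (1 + (1 + a4) ^ f / a3) ^ e / a4 := by rw [← e5]; field_simp
    obtain rfl : a2 = (1 + a3) ^ e / a4 := by rw [← e3]; field_simp
    obtain rfl : a1 = (1 + (1 + a3) ^ e / a4) ^ f / a3 := by rw [← e2]; field_simp
    obtain rfl : a0 = (1 + (1 + (1 + a3) ^ e / a4) ^ f / a3) ^ e / ((1 + a3) ^ e / a4) := by
      rw [← e1]; field_simp
    clear e1 e2 e3 e4 e5
    rcases hef with ⟨rfl, rfl⟩ | ⟨rfl, rfl⟩
    · field_simp
      ring
    · field_simp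
      ring
  have h35 : a5 ^ e * a3 ^ e = (1 + a4) ^ 3 := by
    rw [← mul_pow, e4, ← pow_mul]
    rcases hef with ⟨rfl, rfl⟩ | ⟨rfl, rfl⟩ <;> rfl
  simp only [div_pow]
  rw [← e3, ← e5]
  have : a3 ^ e = (1 + a4) ^ 3 / a5 ^ e := by rw [← h35]; field_simp
  rw [this]
  field_simp
  linarith

/-- **The dual-root formula for the coefficients `r_k` (finite case).**
With `q_m = u_m/(1+u_m)` and `r_m = 1/(1+u_m)`, one has
`r_k = ∏_{m=0}^{h−2} q_{k+m+2}^{c(⟨k+1⟩, m)}` for every `k ∈ ℤ`. -/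
theorem dual_root_coefficient_formula
    (b c : ℕ) (hbc : (0 < b ∧ 0 < c) ∨ (b = 0 ∧ c = 0)) (hfin : b * c ≤ 3)
    (h : ℕ)
    (hh : h = if b * c = 0 then 2 else if b * c = 1 then 3 else if b * c = 2 then 4 else 6)
    (u : ℤ → ℝ) (hpos : ∀ m : ℤ, 0 < u m)
    (hodd : ∀ m : ℤ, Odd m → u (m + 1) * u (m - 1) = (1 + u m) ^ c)
    (heven : ∀ m : ℤ, Even m → u (m + 1) * u (m - 1) = (1 + u m) ^ b) :
    ∀ k : ℤ, 1 / (1 + u k) =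
      ∏ m ∈ Finset.range (h - 1),
        (u (k + m + 2) / (1 + u (k + m + 2))) ^
          (dualRootCoef (b : ℤ) (c : ℤ) (if k % 2 = 0 then 1 else 2) m) := by
  intro k
  have hb : b ≤ 3 := by
    rcases hbc with ⟨h1, h2⟩ | ⟨h1, h2⟩ <;> nlinarith
  have hc : c ≤ 3 := by
    rcases hbc with ⟨h1, h2⟩ | ⟨h1, h2⟩ <;> nlinarith
  have main : ∀ e f : ℕ, (∀ m : ℤ, Even m → u (k + m + 2) * u (k + m) = (1 + u (k + m + 1)) ^ e) →
      (∀ m : ℤ, Odd m → u (k + m + 2) * u (k + m) = (1 + u (k + m + 1)) ^ f) →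
      (u (k + 2) * u k = (1 + u (k + 1)) ^ e ∧ u (k + 3) * u (k + 1) = (1 + u (k + 2)) ^ f ∧
       u (k + 4) * u (k + 2) = (1 + u (k + 3)) ^ e ∧
       u (k + 5) * u (k + 3) = (1 + u (k + 4)) ^ f ∧
       u (k + 6) * u (k + 4) = (1 + u (k + 5)) ^ e) := by
    intro e f he hf
    have t0 := he 0 (by decide)
    have t1 := hf 1 (by decide)
    have t2 := he 2 (by decide)
    have t3 := hf 3 (by decide)
    have t4 := he 4 (by decide)
    simp only [add_assoc, add_zero] at t0 t1 t2 t3 t4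
    norm_num at t0 t1 t2 t3 t4
    exact ⟨t0, t1, t2, t3, t4⟩
  have p := fun j : ℤ => hpos (k + j)
  have p0 := hpos k
  have hO : ∀ m : ℤ, Odd (k + m + 1) → u (k + m + 2) * u (k + m) = (1 + u (k + m + 1)) ^ c := by
    intro m hm
    have := hodd _ hm
    rwa [show k + m + 1 + 1 = k + m + 2 by ring, show k + m + 1 - 1 = k + m by ring] at this
  have hE : ∀ m : ℤ, Even (k + m + 1) → u (k + m + 2) * u (k + m) = (1 + u (k + m + 1)) ^ b := by
    intro m hm
    have := heven _ hm
    rwa [show k + m + 1 + 1 = k + m + 2 by ring, show k + m + 1 - 1 = k + m by ring] at this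
  have a2 : k + 1 + 2 = k + 3 := by ring
  have a3 : k + 2 + 2 = k + 4 := by ring
  have a4 : k + 3 + 2 = k + 5 := by ring
  have a5 : k + 4 + 2 = k + 6 := by ring
  rcases Int.even_or_odd k with hk | hk
  · obtain ⟨e1, e2, e3, e4, e5⟩ := main c b
      (fun m hm => hO m (by grind)) (fun m hm => hE m (by grind))
    rw [if_pos (Int.even_iff.mp hk)]
    clear main hO hE hodd heven
    interval_cases b <;> interval_cases c <;> simp at hbc hfin hh <;> subst hh <;>
      simp [Finset.prod_range_succ, dualRootCoef, dualW1, dualRefl1, dualRefl2, a2, a3, a4, a5,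
        -div_pow, -one_div] <;> norm_cast
    · simpa using core2 _ _ p0 (p 2) (by simpa using e1)
    · simpa using core3 _ _ _ _ p0 (p 1) (p 2) (p 3) (by simpa using e1) (by simpa using e2)
    · simpa using core4 2 1 (by simp) _ _ _ _ _ p0 (p 1) (p 2) (p 3) (p 4) e1 e2 e3
    · simpa using core6 3 1 (by simp) _ _ _ _ _ _ _ p0 (p 1) (p 2) (p 3) (p 4) (p 5) (p 6) e1 e2 e3 e4 e5
    · simpa using core4 1 2 (by simp) _ _ _ _ _ p0 (p 1) (p 2) (p 3) (p 4) e1 e2 e3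
    · simpa using core6 1 3 (by simp) _ _ _ _ _ _ _ p0 (p 1) (p 2) (p 3) (p 4) (p 5) (p 6) e1 e2 e3 e4 e5
  · obtain ⟨e1, e2, e3, e4, e5⟩ := main b c
      (fun m hm => hE m (by grind)) (fun m hm => hO m (by grind))
    rw [if_neg (by have := Int.odd_iff.mp hk; omega)]
    clear main hO hE hodd heven
    interval_cases b <;> interval_cases c <;> simp at hbc hfin hh <;> subst hh <;>
      simp [Finset.prod_range_succ, dualRootCoef, dualW2, dualRefl1, dualRefl2, a2, a3, a4, a5,
        -div_pow, -one_div] <;> norm_cast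
    · simpa using core2 _ _ p0 (p 2) (by simpa using e1)
    · simpa using core3 _ _ _ _ p0 (p 1) (p 2) (p 3) (by simpa using e1) (by simpa using e2)
    · simpa using core4 1 2 (by simp) _ _ _ _ _ p0 (p 1) (p 2) (p 3) (p 4) e1 e2 e3
    · simpa using core6 1 3 (by simp) _ _ _ _ _ _ _ p0 (p 1) (p 2) (p 3) (p 4) (p 5) (p 6) e1 e2 e3 e4 e5
    · simpa using core4 2 1 (by simp) _ _ _ _ _ p0 (p 1) (p 2) (p 3) (p 4) e1 e2 e3
    · simpa using core6 3 1 (by simp) _ _ _ _ _ _ _ p0 (p 1) (p 2) (p 3) (p 4) (p 5) (p 6) e1 e2 e3 e4 e5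
end

section
/- Let (u_m), m ∈ ℤ, be a sequence of positive real numbers satisfying u_m u_{m+2} = (1 + u_{m+1})^{b_⟨m⟩} for all m, and let (d_m), m ∈ ℤ, be a sequence of integers satisfying d_m + d_{m+2} = b_⟨m⟩ · max(d_{m+1}, 0) for all m. Then ∏_{m=1}^{h+2} u_{m+1}^{max(d_m,0)} (1 + u_{m+1})^{−d_m} = 1. -/
theorem aux_term (x : ℝ) (hx : 0 < x) (d : ℤ) :
    x ^ (max d 0) * (1 + x) ^ (-d) =
      Real.exp (((max d 0 : ℤ) : ℝ) * Real.log x - (d : ℝ) * Real.log (1 + x)) := by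
  have h1 : 0 < 1 + x := by linarith
  have e : ((max d 0 : ℤ) : ℝ) * Real.log x - (d : ℝ) * Real.log (1 + x)
      = Real.log (x ^ (max d 0) * (1 + x) ^ (-d)) := by
    rw [Real.log_mul (zpow_pos hx _).ne' (zpow_pos h1 _).ne', Real.log_zpow, Real.log_zpow]
    push_cast
    ring
  rw [e, Real.exp_log (mul_pos (zpow_pos hx _) (zpow_pos h1 _))]

theorem aux_main (b1 b2 : ℕ) (hb1 : 0 < b1) (hb2 : 0 < b2) (N : ℕ)
    (hN : Even N ∨ b1 = b2)
    (u : ℤ → ℝ) (hpos : ∀ m : ℤ, 0 < u m)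
    (hu : ∀ m : ℤ, u m * u (m + 2) = (1 + u (m + 1)) ^ (if Odd m then b1 else b2))
    (d : ℤ → ℤ)
    (hd : ∀ m : ℤ, d m + d (m + 2) =
      (if Odd m then (b1 : ℤ) else (b2 : ℤ)) * max (d (m + 1)) 0)
    (hd0 : d 0 = d N) (hd1 : d 1 = d (N + 1))
    (hu1 : u 1 = u (N + 1)) (hu2 : u 2 = u (N + 2)) :
    ∏ i ∈ Finset.range N,
        u ((i : ℤ) + 2) ^ (max (d ((i : ℤ) + 1)) 0) *
          (1 + u ((i : ℤ) + 2)) ^ (-(d ((i : ℤ) + 1))) = 1 := by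
  obtain ⟨b, hbdef⟩ : ∃ b : ℤ → ℕ, ∀ m, b m = if Odd m then b1 else b2 := ⟨_, fun _ => rfl⟩
  have hbpos : ∀ m, (b m : ℝ) ≠ 0 := by
    intro m
    rw [hbdef]
    split_ifs <;> positivity
  have hb22 : ∀ m, b (m + 2) = b m := by
    intro m
    rw [hbdef, hbdef]
    have : Odd (m + 2) ↔ Odd m := by
      simp [Int.odd_add, Int.odd_iff]
    simp [this]
  have hlog : ∀ m, Real.log (u m) + Real.log (u (m + 2)) = b m * Real.log (1 + u (m + 1)) := by
    intro m
    rw [← Real.log_mul (hpos _).ne' (hpos _).ne', hu, Real.log_pow, hbdef]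
  have hdr : ∀ m, (d m : ℝ) + d (m + 2) = b m * ((max (d (m + 1)) 0 : ℤ) : ℝ) := by
    intro m
    have := hd m
    have h2 : (if Odd m then (b1 : ℤ) else (b2 : ℤ)) = ((b m : ℕ) : ℤ) := by
      rw [hbdef]; split_ifs <;> rfl
    rw [h2] at this
    exact_mod_cast this
  have hbN : b N = b 0 ∧ b (N + 1) = b 1 := by
    rw [hbdef, hbdef, hbdef, hbdef]
    rcases hN with hN | hN
    · have h1 : Even (N : ℤ) := by exact_mod_cast hN
      have h2 : Odd ((N : ℤ) + 1) := h1.add_one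
      have h3 : ¬ Odd (N : ℤ) := by simpa using h1
      simp [h2, h3]
    · subst hN; simp
  simp_rw [aux_term _ (hpos _)]
  rw [← Real.exp_sum]
  rw [Real.exp_eq_one_iff]
  let F : ℕ → ℝ := fun i => (d ((i : ℤ) + 1) : ℝ) * Real.log (u ((i : ℤ) + 1)) / b ((i : ℤ) + 1)
    - (d (i : ℤ) : ℝ) * Real.log (u ((i : ℤ) + 2)) / b (i : ℤ)
  have key : ∀ i ∈ Finset.range N, ((max (d ((i : ℤ) + 1)) 0 : ℤ) : ℝ) * Real.log (u ((i : ℤ) + 2))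
      - (d ((i : ℤ) + 1) : ℝ) * Real.log (1 + u ((i : ℤ) + 2)) = F (i + 1) - F i := by
    intro i _
    have h1 := hlog ((i : ℤ) + 1)
    have h2 := hdr (i : ℤ)
    have h3 := hb22 (i : ℤ)
    have e1 : (i : ℤ) + 1 + 1 = i + 2 := by ring
    have e2 : (i : ℤ) + 1 + 2 = i + 3 := by ring
    simp only [F, Nat.cast_add, Nat.cast_one]
    rw [e1, e2] at h1
    rw [e1, e2, h3]
    have p1 := hbpos (i : ℤ)
    have p2 := hbpos ((i : ℤ) + 1)
    have h1' : Real.log (1 + u ((i : ℤ) + 2))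
      = (Real.log (u ((i : ℤ) + 1)) + Real.log (u ((i : ℤ) + 3))) / b ((i : ℤ) + 1) := by
      rw [h1]; field_simp
    have h2' : ((max (d ((i : ℤ) + 1)) 0 : ℤ) : ℝ) = ((d i : ℝ) + d ((i : ℤ) + 2)) / b (i : ℤ) := by
      rw [h2]; field_simp
    rw [h1', h2']
    ring
  rw [Finset.sum_congr rfl key, Finset.sum_range_sub]
  simp only [F]
  rw [hbN.1, hbN.2, ← hd0, ← hd1, ← hu1, ← hu2]
  simp

theorem aux_d_5_11 (d0 d1 d2 d3 d4 d5 : ℤ)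
    (h1 : d0 + d2 = 1 * max d1 0)
    (h2 : d1 + d3 = 1 * max d2 0)
    (h3 : d2 + d4 = 1 * max d3 0)
    (h4 : d3 + d5 = 1 * max d4 0) :
    d0 = d5 := by
  omega

theorem aux_u_5_11 (x0 x1 x2 x3 x4 x5 : ℝ)
    (p2 : 0 < x2) (p3 : 0 < x3)
    (h1 : x0 * x2 = (1 + x1) ^ 1)
    (h2 : x1 * x3 = (1 + x2) ^ 1)
    (h3 : x2 * x4 = (1 + x3) ^ 1)
    (h4 : x3 * x5 = (1 + x4) ^ 1) :
    x0 = x5 := by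
  have e1 : x1 = (1 + x2) ^ 1 / x3 := by
    rw [eq_div_iff p3.ne', h2]
  have e4 : x4 = (1 + x3) ^ 1 / x2 := by
    rw [eq_div_iff p2.ne', mul_comm, h3]
  have e0 : x0 = (1 + x1) ^ 1 / x2 := by
    rw [eq_div_iff p2.ne', h1]
  have e5 : x5 = (1 + x4) ^ 1 / x3 := by
    rw [eq_div_iff p3.ne', mul_comm, h4]
  clear h1 h2 h3 h4
  subst e5 e0 e4 e1
  field_simp
  ring

theorem aux_d_6_12 (d0 d1 d2 d3 d4 d5 d6 : ℤ)
    (h1 : d0 + d2 = 1 * max d1 0)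
    (h2 : d1 + d3 = 2 * max d2 0)
    (h3 : d2 + d4 = 1 * max d3 0)
    (h4 : d3 + d5 = 2 * max d4 0)
    (h5 : d4 + d6 = 1 * max d5 0) :
    d0 = d6 := by
  omega

theorem aux_u_6_12 (x0 x1 x2 x3 x4 x5 x6 : ℝ)
    (p2 : 0 < x2) (p3 : 0 < x3) (p4 : 0 < x4)
    (h1 : x0 * x2 = (1 + x1) ^ 1)
    (h2 : x1 * x3 = (1 + x2) ^ 2)
    (h3 : x2 * x4 = (1 + x3) ^ 1)
    (h4 : x3 * x5 = (1 + x4) ^ 2)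
    (h5 : x4 * x6 = (1 + x5) ^ 1) :
    x0 = x6 := by
  have e2 : x2 = (1 + x3) ^ 1 / x4 := by
    rw [eq_div_iff p4.ne', h3]
  have e5 : x5 = (1 + x4) ^ 2 / x3 := by
    rw [eq_div_iff p3.ne', mul_comm, h4]
  have e1 : x1 = (1 + x2) ^ 2 / x3 := by
    rw [eq_div_iff p3.ne', h2]
  have e6 : x6 = (1 + x5) ^ 1 / x4 := by
    rw [eq_div_iff p4.ne', mul_comm, h5]
  have e0 : x0 = (1 + x1) ^ 1 / x2 := by
    rw [eq_div_iff p2.ne', h1]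
  clear h1 h2 h3 h4 h5
  clear p2 
  subst e0 e6 e1 e5 e2
  field_simp
  ring

theorem aux_d_6_21 (d0 d1 d2 d3 d4 d5 d6 : ℤ)
    (h1 : d0 + d2 = 2 * max d1 0)
    (h2 : d1 + d3 = 1 * max d2 0)
    (h3 : d2 + d4 = 2 * max d3 0)
    (h4 : d3 + d5 = 1 * max d4 0)
    (h5 : d4 + d6 = 2 * max d5 0) :
    d0 = d6 := by
  omega

theorem aux_u_6_21 (x0 x1 x2 x3 x4 x5 x6 : ℝ)
    (p2 : 0 < x2) (p3 : 0 < x3) (p4 : 0 < x4)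
    (h1 : x0 * x2 = (1 + x1) ^ 2)
    (h2 : x1 * x3 = (1 + x2) ^ 1)
    (h3 : x2 * x4 = (1 + x3) ^ 2)
    (h4 : x3 * x5 = (1 + x4) ^ 1)
    (h5 : x4 * x6 = (1 + x5) ^ 2) :
    x0 = x6 := by
  have e2 : x2 = (1 + x3) ^ 2 / x4 := by
    rw [eq_div_iff p4.ne', h3]
  have e5 : x5 = (1 + x4) ^ 1 / x3 := by
    rw [eq_div_iff p3.ne', mul_comm, h4]
  have e1 : x1 = (1 + x2) ^ 1 / x3 := by
    rw [eq_div_iff p3.ne', h2]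
  have e6 : x6 = (1 + x5) ^ 2 / x4 := by
    rw [eq_div_iff p4.ne', mul_comm, h5]
  have e0 : x0 = (1 + x1) ^ 2 / x2 := by
    rw [eq_div_iff p2.ne', h1]
  clear h1 h2 h3 h4 h5
  clear p2 
  subst e0 e6 e1 e5 e2
  field_simp
  ring

theorem aux_d_8_13 (d0 d1 d2 d3 d4 d5 d6 d7 d8 : ℤ)
    (h1 : d0 + d2 = 1 * max d1 0)
    (h2 : d1 + d3 = 3 * max d2 0)
    (h3 : d2 + d4 = 1 * max d3 0)
    (h4 : d3 + d5 = 3 * max d4 0)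
    (h5 : d4 + d6 = 1 * max d5 0)
    (h6 : d5 + d7 = 3 * max d6 0)
    (h7 : d6 + d8 = 1 * max d7 0) :
    d0 = d8 := by
  omega

theorem aux_u_8_13 (x0 x1 x2 x3 x4 x5 x6 x7 x8 : ℝ)
    (p2 : 0 < x2) (p3 : 0 < x3) (p4 : 0 < x4) (p5 : 0 < x5) (p6 : 0 < x6)
    (h1 : x0 * x2 = (1 + x1) ^ 1)
    (h2 : x1 * x3 = (1 + x2) ^ 3)
    (h3 : x2 * x4 = (1 + x3) ^ 1)
    (h4 : x3 * x5 = (1 + x4) ^ 3)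
    (h5 : x4 * x6 = (1 + x5) ^ 1)
    (h6 : x5 * x7 = (1 + x6) ^ 3)
    (h7 : x6 * x8 = (1 + x7) ^ 1) :
    x0 = x8 := by
  have e3 : x3 = (1 + x4) ^ 3 / x5 := by
    rw [eq_div_iff p5.ne', h4]
  have e6 : x6 = (1 + x5) ^ 1 / x4 := by
    rw [eq_div_iff p4.ne', mul_comm, h5]
  have e2 : x2 = (1 + x3) ^ 1 / x4 := by
    rw [eq_div_iff p4.ne', h3]
  have e7 : x7 = (1 + x6) ^ 3 / x5 := by
    rw [eq_div_iff p5.ne', mul_comm, h6]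
  have e1 : x1 = (1 + x2) ^ 3 / x3 := by
    rw [eq_div_iff p3.ne', h2]
  have e8 : x8 = (1 + x7) ^ 1 / x6 := by
    rw [eq_div_iff p6.ne', mul_comm, h7]
  have e0 : x0 = (1 + x1) ^ 1 / x2 := by
    rw [eq_div_iff p2.ne', h1]
  clear h1 h2 h3 h4 h5 h6 h7
  clear p2 p3 p6 
  have g3 : x3 = (1+x4)^3/x5 := by
    rw [e3]
    try field_simp
    try ring
  have g6 : x6 = (1+x5)/x4 := by
    rw [e6]
    try field_simp
    try ring
  have g2 : x2 = (x5+(1+x4)^3)/(x4*x5) := by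
    rw [e2, g3]
    try field_simp
    try ring
  have g7 : x7 = (1+x4+x5)^3/(x4^3*x5) := by
    rw [e7, g6]
    try field_simp
    try ring
  have g1 : x1 = (x5+(1+x4)^2)^3/(x4^3*x5^2) := by
    rw [e1, g2, g3]
    try field_simp
    try ring
  rw [e0, e8, g1, g2, g7, g6]
  field_simp
  ring

theorem aux_d_8_31 (d0 d1 d2 d3 d4 d5 d6 d7 d8 : ℤ)
    (h1 : d0 + d2 = 3 * max d1 0)
    (h2 : d1 + d3 = 1 * max d2 0)
    (h3 : d2 + d4 = 3 * max d3 0)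
    (h4 : d3 + d5 = 1 * max d4 0)
    (h5 : d4 + d6 = 3 * max d5 0)
    (h6 : d5 + d7 = 1 * max d6 0)
    (h7 : d6 + d8 = 3 * max d7 0) :
    d0 = d8 := by
  omega

theorem aux_u_8_31 (x0 x1 x2 x3 x4 x5 x6 x7 x8 : ℝ)
    (p2 : 0 < x2) (p3 : 0 < x3) (p4 : 0 < x4) (p5 : 0 < x5) (p6 : 0 < x6)
    (h1 : x0 * x2 = (1 + x1) ^ 3)
    (h2 : x1 * x3 = (1 + x2) ^ 1)
    (h3 : x2 * x4 = (1 + x3) ^ 3)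
    (h4 : x3 * x5 = (1 + x4) ^ 1)
    (h5 : x4 * x6 = (1 + x5) ^ 3)
    (h6 : x5 * x7 = (1 + x6) ^ 1)
    (h7 : x6 * x8 = (1 + x7) ^ 3) :
    x0 = x8 := by
  have e3 : x3 = (1 + x4) ^ 1 / x5 := by
    rw [eq_div_iff p5.ne', h4]
  have e6 : x6 = (1 + x5) ^ 3 / x4 := by
    rw [eq_div_iff p4.ne', mul_comm, h5]
  have e2 : x2 = (1 + x3) ^ 3 / x4 := by
    rw [eq_div_iff p4.ne', h3]
  have e7 : x7 = (1 + x6) ^ 1 / x5 := by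
    rw [eq_div_iff p5.ne', mul_comm, h6]
  have e1 : x1 = (1 + x2) ^ 1 / x3 := by
    rw [eq_div_iff p3.ne', h2]
  have e8 : x8 = (1 + x7) ^ 3 / x6 := by
    rw [eq_div_iff p6.ne', mul_comm, h7]
  have e0 : x0 = (1 + x1) ^ 3 / x2 := by
    rw [eq_div_iff p2.ne', h1]
  clear h1 h2 h3 h4 h5 h6 h7
  clear p2 p3 p6 
  have g3 : x3 = (1+x4)/x5 := by
    rw [e3]
    try field_simp
    try ring
  have g6 : x6 = (1+x5)^3/x4 := by
    rw [e6]
    try field_simp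
    try ring
  have g2 : x2 = (1+x4+x5)^3/(x4*x5^3) := by
    rw [e2, g3]
    try field_simp
    try ring
  have g7 : x7 = (x4+(1+x5)^3)/(x4*x5) := by
    rw [e7, g6]
    try field_simp
    try ring
  have g1 : x1 = ((1+x4+x5)^3+x4*x5^3)/(x4*x5^2*(1+x4)) := by
    rw [e1, g2, g3]
    try field_simp
    try ring
  rw [e0, e8, g1, g2, g7, g6]
  field_simp
  ring

theorem aux_case_00 (u : ℤ → ℝ) (hpos : ∀ m : ℤ, 0 < u m)
    (hu : ∀ m : ℤ, u m * u (m + 2) = 1)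
    (d : ℤ → ℤ) (hd : ∀ m : ℤ, d m + d (m + 2) = 0) :
    ∏ i ∈ Finset.range 4,
        u ((i : ℤ) + 2) ^ (max (d ((i : ℤ) + 1)) 0) *
          (1 + u ((i : ℤ) + 2)) ^ (-(d ((i : ℤ) + 1))) = 1 := by
  have key : ∀ (x y : ℝ) (a b : ℤ), 0 < x → 0 < y → x * y = 1 → a + b = 0 →
      x ^ (max a 0) * (1 + x) ^ (-a) * (y ^ (max b 0) * (1 + y) ^ (-b)) = 1 := by
    intro x y a b hx hy hxy hab
    have hb : b = -a := by omega
    have hy' : y = x⁻¹ := eq_inv_of_mul_eq_one_right hxy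
    subst hb
    have h1 : (1 + x⁻¹) = (1 + x) * x⁻¹ := by field_simp; ring
    have h2 : (1 + x) ≠ 0 := by positivity
    rw [hy', h1, mul_zpow, neg_neg, inv_zpow', inv_zpow']
    have : x ^ max a 0 * (1 + x) ^ (-a) * (x ^ (-max (-a) 0) * ((1 + x) ^ a * x ^ (-a)))
      = (x ^ max a 0 * x ^ (-max (-a) 0) * x ^ (-a)) * ((1 + x) ^ (-a) * (1 + x) ^ a) := by ring
    rw [this, ← zpow_add₀ hx.ne', ← zpow_add₀ hx.ne', ← zpow_add₀ h2]
    have e1 : max a 0 + -max (-a) 0 + -a = 0 := by omega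
    rw [e1]
    simp
  have k1 := key (u 2) (u 4) (d 1) (d 3) (hpos _) (hpos _) (hu 2) (hd 1)
  have k2 := key (u 3) (u 5) (d 2) (d 4) (hpos _) (hpos _) (hu 3) (hd 2)
  simp only [Finset.prod_range_succ, Finset.prod_range_zero]
  have c0 : ((0 : ℕ) : ℤ) + 2 = 2 := rfl
  have c1 : ((1 : ℕ) : ℤ) + 2 = 3 := rfl
  have c2 : ((2 : ℕ) : ℤ) + 2 = 4 := rfl
  have c3 : ((3 : ℕ) : ℤ) + 2 = 5 := rfl
  have f0 : ((0 : ℕ) : ℤ) + 1 = 1 := rfl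
  have f1 : ((1 : ℕ) : ℤ) + 1 = 2 := rfl
  have f2 : ((2 : ℕ) : ℤ) + 1 = 3 := rfl
  have f3 : ((3 : ℕ) : ℤ) + 1 = 4 := rfl
  rw [c0, c1, c2, c3, f0, f1, f2, f3, one_mul]
  rw [mul_right_comm (u 2 ^ _ * _), k1, one_mul, k2]

/-- **The key product identity in the proof of rank-2 periodicity of exchange
graphs.**  Let `b₁, b₂` be either both positive with `b₁b₂ ≤ 3` or both zero,
with Coxeter number `h`.  Write `b_⟨m⟩ = b₁` for `m` odd and `b_⟨m⟩ = b₂` for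
`m` even.  If `(u_m)` are positive reals with
`u_m u_{m+2} = (1 + u_{m+1})^{b_⟨m⟩}` and `(d_m)` are integers with
`d_m + d_{m+2} = b_⟨m⟩ · max(d_{m+1}, 0)`, then
`∏_{m=1}^{h+2} u_{m+1}^{max(d_m,0)} (1 + u_{m+1})^{−d_m} = 1`. -/
theorem rank_two_coefficient_product_identity
    (b1 b2 : ℕ)
    (hb : (0 < b1 ∧ 0 < b2 ∧ b1 * b2 ≤ 3) ∨ (b1 = 0 ∧ b2 = 0))
    (h : ℕ)
    (hh : h = if b1 * b2 = 0 then 2 else if b1 * b2 = 1 then 3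
      else if b1 * b2 = 2 then 4 else 6)
    (u : ℤ → ℝ) (hpos : ∀ m : ℤ, 0 < u m)
    (hu : ∀ m : ℤ, u m * u (m + 2) = (1 + u (m + 1)) ^ (if Odd m then b1 else b2))
    (d : ℤ → ℤ)
    (hd : ∀ m : ℤ, d m + d (m + 2) =
      (if Odd m then (b1 : ℤ) else (b2 : ℤ)) * max (d (m + 1)) 0) :
    ∏ i ∈ Finset.range (h + 2),
        u ((i : ℤ) + 2) ^ (max (d ((i : ℤ) + 1)) 0) *
          (1 + u ((i : ℤ) + 2)) ^ (-(d ((i : ℤ) + 1))) = 1 := by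
  have hc : (b1 = 1 ∧ b2 = 1) ∨ (b1 = 1 ∧ b2 = 2) ∨ (b1 = 2 ∧ b2 = 1) ∨ (b1 = 1 ∧ b2 = 3) ∨
      (b1 = 3 ∧ b2 = 1) ∨ (b1 = 0 ∧ b2 = 0) := by
    rcases hb with ⟨h1, h2, h3⟩ | hb
    · have : b1 ≤ 3 := by nlinarith
      have : b2 ≤ 3 := by nlinarith
      interval_cases b1 <;> interval_cases b2 <;> simp_all
    · simp [hb]
  clear hb
  have uo : ∀ m : ℤ, Odd m → u m * u (m + 2) = (1 + u (m + 1)) ^ b1 := by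
    intro m hm; have := hu m; rwa [if_pos hm] at this
  have ue : ∀ m : ℤ, ¬ Odd m → u m * u (m + 2) = (1 + u (m + 1)) ^ b2 := by
    intro m hm; have := hu m; rwa [if_neg hm] at this
  have dd : ∀ m : ℤ, Odd m → d m + d (m + 2) = b1 * max (d (m + 1)) 0 := by
    intro m hm; have := hd m; rwa [if_pos hm] at this
  have de : ∀ m : ℤ, ¬ Odd m → d m + d (m + 2) = b2 * max (d (m + 1)) 0 := by
    intro m hm; have := hd m; rwa [if_neg hm] at this
  rcases hc with ⟨rfl, rfl⟩ | ⟨rfl, rfl⟩ | ⟨rfl, rfl⟩ | ⟨rfl, rfl⟩ | ⟨rfl, rfl⟩ | ⟨rfl, rfl⟩ <;>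
    norm_num at hh <;> subst hh
  · refine aux_main 1 1 (by norm_num) (by norm_num) 5 (by decide) u hpos hu d hd ?_ ?_ ?_ ?_
    · exact aux_d_5_11 (d 0) (d 1) (d 2) (d 3) (d 4) (d 5)
          (de 0 (by decide)) (dd 1 (by decide)) (de 2 (by decide)) (dd 3 (by decide))
    · exact aux_d_5_11 (d 1) (d 2) (d 3) (d 4) (d 5) (d 6)
          (dd 1 (by decide)) (de 2 (by decide)) (dd 3 (by decide)) (de 4 (by decide))
    · exact aux_u_5_11 (u 1) (u 2) (u 3) (u 4) (u 5) (u 6)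
          (hpos _) (hpos _)
          (uo 1 (by decide)) (ue 2 (by decide)) (uo 3 (by decide)) (ue 4 (by decide))
    · exact aux_u_5_11 (u 2) (u 3) (u 4) (u 5) (u 6) (u 7)
          (hpos _) (hpos _)
          (ue 2 (by decide)) (uo 3 (by decide)) (ue 4 (by decide)) (uo 5 (by decide))
  · refine aux_main 1 2 (by norm_num) (by norm_num) 6 (by decide) u hpos hu d hd ?_ ?_ ?_ ?_
    · exact aux_d_6_21 (d 0) (d 1) (d 2) (d 3) (d 4) (d 5) (d 6)
          (de 0 (by decide)) (dd 1 (by decide)) (de 2 (by decide)) (dd 3 (by decide)) (de 4 (by decide))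
    · exact aux_d_6_12 (d 1) (d 2) (d 3) (d 4) (d 5) (d 6) (d 7)
          (dd 1 (by decide)) (de 2 (by decide)) (dd 3 (by decide)) (de 4 (by decide)) (dd 5 (by decide))
    · exact aux_u_6_12 (u 1) (u 2) (u 3) (u 4) (u 5) (u 6) (u 7)
          (hpos _) (hpos _) (hpos _)
          (uo 1 (by decide)) (ue 2 (by decide)) (uo 3 (by decide)) (ue 4 (by decide)) (uo 5 (by decide))
    · exact aux_u_6_21 (u 2) (u 3) (u 4) (u 5) (u 6) (u 7) (u 8)
          (hpos _) (hpos _) (hpos _)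
          (ue 2 (by decide)) (uo 3 (by decide)) (ue 4 (by decide)) (uo 5 (by decide)) (ue 6 (by decide))
  · refine aux_main 2 1 (by norm_num) (by norm_num) 6 (by decide) u hpos hu d hd ?_ ?_ ?_ ?_
    · exact aux_d_6_12 (d 0) (d 1) (d 2) (d 3) (d 4) (d 5) (d 6)
          (de 0 (by decide)) (dd 1 (by decide)) (de 2 (by decide)) (dd 3 (by decide)) (de 4 (by decide))
    · exact aux_d_6_21 (d 1) (d 2) (d 3) (d 4) (d 5) (d 6) (d 7)
          (dd 1 (by decide)) (de 2 (by decide)) (dd 3 (by decide)) (de 4 (by decide)) (dd 5 (by decide))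
    · exact aux_u_6_21 (u 1) (u 2) (u 3) (u 4) (u 5) (u 6) (u 7)
          (hpos _) (hpos _) (hpos _)
          (uo 1 (by decide)) (ue 2 (by decide)) (uo 3 (by decide)) (ue 4 (by decide)) (uo 5 (by decide))
    · exact aux_u_6_12 (u 2) (u 3) (u 4) (u 5) (u 6) (u 7) (u 8)
          (hpos _) (hpos _) (hpos _)
          (ue 2 (by decide)) (uo 3 (by decide)) (ue 4 (by decide)) (uo 5 (by decide)) (ue 6 (by decide))
  · refine aux_main 1 3 (by norm_num) (by norm_num) 8 (by decide) u hpos hu d hd ?_ ?_ ?_ ?_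
    · exact aux_d_8_31 (d 0) (d 1) (d 2) (d 3) (d 4) (d 5) (d 6) (d 7) (d 8)
          (de 0 (by decide)) (dd 1 (by decide)) (de 2 (by decide)) (dd 3 (by decide)) (de 4 (by decide)) (dd 5 (by decide)) (de 6 (by decide))
    · exact aux_d_8_13 (d 1) (d 2) (d 3) (d 4) (d 5) (d 6) (d 7) (d 8) (d 9)
          (dd 1 (by decide)) (de 2 (by decide)) (dd 3 (by decide)) (de 4 (by decide)) (dd 5 (by decide)) (de 6 (by decide)) (dd 7 (by decide))
    · exact aux_u_8_13 (u 1) (u 2) (u 3) (u 4) (u 5) (u 6) (u 7) (u 8) (u 9)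
          (hpos _) (hpos _) (hpos _) (hpos _) (hpos _)
          (uo 1 (by decide)) (ue 2 (by decide)) (uo 3 (by decide)) (ue 4 (by decide)) (uo 5 (by decide)) (ue 6 (by decide)) (uo 7 (by decide))
    · exact aux_u_8_31 (u 2) (u 3) (u 4) (u 5) (u 6) (u 7) (u 8) (u 9) (u 10)
          (hpos _) (hpos _) (hpos _) (hpos _) (hpos _)
          (ue 2 (by decide)) (uo 3 (by decide)) (ue 4 (by decide)) (uo 5 (by decide)) (ue 6 (by decide)) (uo 7 (by decide)) (ue 8 (by decide))
  · refine aux_main 3 1 (by norm_num) (by norm_num) 8 (by decide) u hpos hu d hd ?_ ?_ ?_ ?_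
    · exact aux_d_8_13 (d 0) (d 1) (d 2) (d 3) (d 4) (d 5) (d 6) (d 7) (d 8)
          (de 0 (by decide)) (dd 1 (by decide)) (de 2 (by decide)) (dd 3 (by decide)) (de 4 (by decide)) (dd 5 (by decide)) (de 6 (by decide))
    · exact aux_d_8_31 (d 1) (d 2) (d 3) (d 4) (d 5) (d 6) (d 7) (d 8) (d 9)
          (dd 1 (by decide)) (de 2 (by decide)) (dd 3 (by decide)) (de 4 (by decide)) (dd 5 (by decide)) (de 6 (by decide)) (dd 7 (by decide))
    · exact aux_u_8_31 (u 1) (u 2) (u 3) (u 4) (u 5) (u 6) (u 7) (u 8) (u 9)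
          (hpos _) (hpos _) (hpos _) (hpos _) (hpos _)
          (uo 1 (by decide)) (ue 2 (by decide)) (uo 3 (by decide)) (ue 4 (by decide)) (uo 5 (by decide)) (ue 6 (by decide)) (uo 7 (by decide))
    · exact aux_u_8_13 (u 2) (u 3) (u 4) (u 5) (u 6) (u 7) (u 8) (u 9) (u 10)
          (hpos _) (hpos _) (hpos _) (hpos _) (hpos _)
          (ue 2 (by decide)) (uo 3 (by decide)) (ue 4 (by decide)) (uo 5 (by decide)) (ue 6 (by decide)) (uo 7 (by decide)) (ue 8 (by decide))
  · exact aux_case_00 u hpos (by simpa using hu) d (by simpa using hd)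
end

section
/- Let α, β, γ be positive integers with αβγ ≥ 3, and let B(α, β, γ) be the 3×3 integer matrix [[0, 2α, −2αβ], [−βγ, 0, 2β], [γ, −αγ, 0]]. Then B(α, β, γ) is sign-skew-symmetric but not skew-symmetrizable. -/
/-- A square integer matrix `B` is sign-skew-symmetric if for all `i, j`, either
`b_{ij} = b_{ji} = 0` or `b_{ij}` and `b_{ji}` have strictly opposite signs. -/
def SignSkewSymmetric {n : ℕ} (B : Matrix (Fin n) (Fin n) ℤ) : Prop :=
  ∀ i j, (B i j = 0 ∧ B j i = 0) ∨ B i j * B j i < 0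

/-- A square integer matrix `B` is skew-symmetrizable if there exist positive
integers `d_i` with `d_i b_{ij} = −d_j b_{ji}` for all `i, j`. -/
def SkewSymmetrizable {n : ℕ} (B : Matrix (Fin n) (Fin n) ℤ) : Prop :=
  ∃ d : Fin n → ℤ, (∀ i, 0 < d i) ∧ ∀ i j, d i * B i j = -(d j * B j i)

/-- For positive integers `α, β, γ` with `αβγ ≥ 3`, the matrix
`B(α,β,γ) = [[0, 2α, −2αβ], [−βγ, 0, 2β], [γ, −αγ, 0]]` is sign-skew-symmetric
but not skew-symmetrizable. -/
theorem B_abc_sign_skew_symmetric_not_skew_symmetrizable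
    (α β γ : ℤ) (hα : 0 < α) (hβ : 0 < β) (hγ : 0 < γ) (h3 : 3 ≤ α * β * γ) :
    SignSkewSymmetric !![0, 2*α, -2*α*β; -β*γ, 0, 2*β; γ, -α*γ, 0] ∧
    ¬ SkewSymmetrizable !![0, 2*α, -2*α*β; -β*γ, 0, 2*β; γ, -α*γ, 0] := by
  have hab := mul_pos hα hβ
  have hbg := mul_pos hβ hγ
  have hag := mul_pos hα hγ
  have p1 : 0 < α * (β * γ) := mul_pos hα hbg
  constructor
  · intro i j
    fin_cases i <;> fin_cases j <;> simp <;> right <;> nlinarith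
  · rintro ⟨d, hd, h⟩
    have h01 := h 0 1
    have h12 := h 1 2
    have h02 := h 0 2
    have hd1 := hd 1
    simp at h01 h12 h02
    have e1 : d 2 = d 1 * β ^ 2 := by
      apply mul_left_cancel₀ hγ.ne'
      linear_combination β * h01 - h02
    rw [e1] at h12
    have e2 : α * β * γ = 2 := by
      apply mul_left_cancel₀ (mul_pos hd1 hβ).ne'
      linear_combination -h12
    omega
end

section
/- Suppose a 3×3 integer matrix B is cyclical and i-biased for some i ∈ {1,2,3}, and let j ∈ {1,2,3} with j ≠ i. Then the mutated matrix μ_j(B) is cyclical and j-biased. -/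
/-- Matrix mutation in direction `k`:
`μ_k(B)_{ij} = −b_{ij}` if `i = k` or `j = k`, and
`μ_k(B)_{ij} = b_{ij} + (|b_{ik}| b_{kj} + b_{ik} |b_{kj}|)/2` otherwise
(the numerator is always even, so the integer division is exact). -/
def mutate {n : ℕ} (B : Matrix (Fin n) (Fin n) ℤ) (k : Fin n) :
    Matrix (Fin n) (Fin n) ℤ :=
  Matrix.of fun i j =>
    if i = k ∨ j = k then -B i j
    else B i j + (|B i k| * B k j + B i k * |B k j|) / 2

/-- A `3×3` integer matrix is cyclical if its diagonal vanishes and its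
off-diagonal entries follow one of the two cyclic sign patterns. -/
def Cyclical (B : Matrix (Fin 3) (Fin 3) ℤ) : Prop :=
  (∀ i, B i i = 0) ∧
  ((0 < B 0 1 ∧ 0 < B 1 2 ∧ 0 < B 2 0 ∧ B 1 0 < 0 ∧ B 2 1 < 0 ∧ B 0 2 < 0) ∨
   (B 0 1 < 0 ∧ B 1 2 < 0 ∧ B 2 0 < 0 ∧ 0 < B 1 0 ∧ 0 < B 2 1 ∧ 0 < B 0 2))

/-- `cVal B i = c_i`, i.e. `c_1 = |b_{23} b_{32}|`, `c_2 = |b_{13} b_{31}|`,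
`c_3 = |b_{12} b_{21}|` (indices taken mod 3, written 0-based). -/
def cVal (B : Matrix (Fin 3) (Fin 3) ℤ) (i : Fin 3) : ℤ :=
  |B (i + 1) (i + 2) * B (i + 2) (i + 1)|

/-- `rVal B = r = |b_{12} b_{23} b_{31}|`. -/
def rVal (B : Matrix (Fin 3) (Fin 3) ℤ) : ℤ := |B 0 1 * B 1 2 * B 2 0|

/-- `B` is `i`-biased if `r > c_i ≥ r/2 ≥ c_j ≥ 6` for all `j ≠ i`
(the middle inequalities stated integrally as `2c_i ≥ r` and `r ≥ 2c_j`). -/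
def Biased (B : Matrix (Fin 3) (Fin 3) ℤ) (i : Fin 3) : Prop :=
  cVal B i < rVal B ∧ rVal B ≤ 2 * cVal B i ∧
    ∀ j, j ≠ i → 2 * cVal B j ≤ rVal B ∧ 6 ≤ cVal B j

/-- Arithmetic core; `x' = a'c'-b`, `y' = ac-b'` are the new entries. -/
theorem core_aux (a b c a' b' c' : ℤ) (ha : 0 < a) (hb : 0 < b) (hc : 0 < c)
    (ha' : 0 < a') (hb' : 0 < b') (hc' : 0 < c')
    (h1 : 2 * (b * b') ≤ a * b * c)
    (h2 : 6 ≤ c * c') (h3 : 6 ≤ a * a')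
    (h : (2 * (a * a') ≤ a * b * c ∧ a * b * c ≤ 2 * (c * c')) ∨
      (2 * (c * c') ≤ a * b * c ∧ a * b * c ≤ 2 * (a * a'))) :
    ∃ x y : ℤ, x = a' * c' - b ∧ y = a * c - b' ∧ 0 < x ∧ 0 < y ∧
      x * y < a * x * c ∧ a * x * c ≤ 2 * (x * y) ∧
      2 * (c * c') ≤ a * x * c ∧ 2 * (a * a') ≤ a * x * c := by
  have hac : 0 < a * c := mul_pos ha hc
  have hy2 : 2 * b' ≤ a * c := by
    have : b * (2 * b') ≤ b * (a * c) := by linarith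
    exact le_of_mul_le_mul_left this hb
  have hr : a * (a' * c' - b) * c = (c * c') * (a * a') - a * b * c := by ring
  have hbig : 2 * (c * c') ≤ a * (a' * c' - b) * c ∧ 2 * (a * a') ≤ a * (a' * c' - b) * c := by
    rw [hr]
    generalize c * c' = C at *
    generalize a * a' = A at *
    generalize a * b * c = r at *
    rcases h with ⟨h4, h5⟩ | ⟨h4, h5⟩ <;> constructor <;> nlinarith
  have hx : 0 < a' * c' - b := by
    by_contra hn
    push Not at hn
    have : a * c * (a' * c' - b) ≤ 0 := mul_nonpos_of_nonneg_of_nonpos hac.le hn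
    nlinarith [hbig.1]
  refine ⟨_, _, rfl, rfl, hx, by linarith, ?_, ?_, hbig⟩ <;> nlinarith [mul_pos hx hb']

theorem matrix_form (B : Matrix (Fin 3) (Fin 3) ℤ) (h : Cyclical B) :
    ∃ a b c a' b' c' : ℤ, 0 < a ∧ 0 < b ∧ 0 < c ∧ 0 < a' ∧ 0 < b' ∧ 0 < c' ∧
      (B = !![0, a, -c'; -a', 0, b; c, -b', 0] ∨ B = !![0, -a, c'; a', 0, -b; -c, b', 0]) := by
  obtain ⟨h0, h | h⟩ := h
  · obtain ⟨h1, h2, h3, h4, h5, h6⟩ := h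
    refine ⟨B 0 1, B 1 2, B 2 0, - B 1 0, - B 2 1, - B 0 2, h1, h2, h3, by linarith, by linarith,
      by linarith, Or.inl ?_⟩
    ext i j; fin_cases i <;> fin_cases j <;> simp [h0]
  · obtain ⟨h1, h2, h3, h4, h5, h6⟩ := h
    refine ⟨-B 0 1, -B 1 2, -B 2 0, B 1 0, B 2 1, B 0 2, by linarith, by linarith,
      by linarith, h4, h5, h6, Or.inr ?_⟩
    ext i j; fin_cases i <;> fin_cases j <;> simp [h0]

/-- Cyclicity and bias of a matrix given in explicit form. -/
theorem biased_form (B : Matrix (Fin 3) (Fin 3) ℤ) (a b c a' b' c' : ℤ)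
    (ha : 0 < a) (hb : 0 < b) (hc : 0 < c)
    (ha' : 0 < a') (hb' : 0 < b') (hc' : 0 < c')
    (h : B = !![0, a, -c'; -a', 0, b; c, -b', 0] ∨ B = !![0, -a, c'; a', 0, -b; -c, b', 0]) :
    Cyclical B ∧ rVal B = a * b * c ∧ cVal B 0 = b * b' ∧ cVal B 1 = c * c' ∧
      cVal B 2 = a * a' := by
  have e1 : (1 : Fin 3) + 1 = 2 := rfl
  have e2 : (1 : Fin 3) + 2 = 0 := rfl
  have e3 : (2 : Fin 3) + 1 = 0 := rfl
  have e4 : (2 : Fin 3) + 2 = 1 := rfl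
  rcases h with rfl | rfl <;>
    simp [Cyclical, rVal, cVal, Fin.forall_fin_succ, abs_mul, abs_of_pos, e1, e2, e3, e4, *] <;>
    ring_nf

theorem half_aux (x y : ℤ) : (x * y + x * y) / 2 = x * y := by omega

theorem half_aux_neg (x y : ℤ) : (-(x * y) + -(x * y)) / 2 = -(x * y) := by omega

theorem biased0 (B : Matrix (Fin 3) (Fin 3) ℤ) : Biased B 0 ↔
    cVal B 0 < rVal B ∧ rVal B ≤ 2 * cVal B 0 ∧ (2 * cVal B 1 ≤ rVal B ∧ 6 ≤ cVal B 1) ∧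
    (2 * cVal B 2 ≤ rVal B ∧ 6 ≤ cVal B 2) := by
  simp [Biased, Fin.forall_fin_succ]

theorem biased1 (B : Matrix (Fin 3) (Fin 3) ℤ) : Biased B 1 ↔
    cVal B 1 < rVal B ∧ rVal B ≤ 2 * cVal B 1 ∧ (2 * cVal B 0 ≤ rVal B ∧ 6 ≤ cVal B 0) ∧
    (2 * cVal B 2 ≤ rVal B ∧ 6 ≤ cVal B 2) := by
  simp [Biased, Fin.forall_fin_succ]

theorem biased2 (B : Matrix (Fin 3) (Fin 3) ℤ) : Biased B 2 ↔
    cVal B 2 < rVal B ∧ rVal B ≤ 2 * cVal B 2 ∧ (2 * cVal B 0 ≤ rVal B ∧ 6 ≤ cVal B 0) ∧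
    (2 * cVal B 1 ≤ rVal B ∧ 6 ≤ cVal B 1) := by
  simp [Biased, Fin.forall_fin_succ]

/-- If `B` is cyclical and `i`-biased and `j ≠ i`, then `μ_j(B)` is cyclical
and `j`-biased. -/
theorem mutation_preserves_cyclical_biased
    (B : Matrix (Fin 3) (Fin 3) ℤ) (i j : Fin 3)
    (hcyc : Cyclical B) (hbias : Biased B i) (hij : j ≠ i) :
    Cyclical (mutate B j) ∧ Biased (mutate B j) j := by
  obtain ⟨a, b, c, a', b', c', ha, hb, hc, ha', hb', hc', hB⟩ := matrix_form B hcyc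
  obtain ⟨-, hr, h0, h1, h2⟩ := biased_form B a b c a' b' c' ha hb hc ha' hb' hc' hB
  have hj : j = 0 ∨ j = 1 ∨ j = 2 := by fin_cases j <;> simp
  have hi : i = 0 ∨ i = 1 ∨ i = 2 := by fin_cases i <;> simp
  rcases hj with rfl | rfl | rfl
  · have H : 2 * (b * b') ≤ a * b * c ∧ 6 ≤ c * c' ∧ 6 ≤ a * a' ∧
        ((2 * (a * a') ≤ a * b * c ∧ a * b * c ≤ 2 * (c * c')) ∨
        (2 * (c * c') ≤ a * b * c ∧ a * b * c ≤ 2 * (a * a'))) := by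
      rcases hi with rfl | rfl | rfl
      · exact absurd rfl hij
      · rw [biased1, hr, h0, h1, h2] at hbias; omega
      · rw [biased2, hr, h0, h1, h2] at hbias; omega
    obtain ⟨H1, H2, H3, H4⟩ := H
    obtain ⟨x, y, hx, hy, hx0, hy0, K1, K2, K3, K4⟩ :=
      core_aux a b c a' b' c' ha hb hc ha' hb' hc' H1 H2 H3 H4
    have := biased_form (mutate B 0) a x c a' y c' ha hx0 hc ha' hy0 hc' (by
      rcases hB with rfl | rfl
      · right
        subst hx hy
        ext p q; fin_cases p <;> fin_cases q <;>
          simp [mutate, abs_of_pos, *, half_aux, half_aux_neg] <;> ring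
      · left
        subst hx hy
        ext p q; fin_cases p <;> fin_cases q <;>
          simp [mutate, abs_of_pos, *, half_aux, half_aux_neg] <;> ring)
    obtain ⟨g, gr, g0, g1, g2⟩ := this
    refine ⟨g, ?_⟩
    rw [biased0, gr, g0, g1, g2]
    omega
  · have H : 2 * (c * c') ≤ b * c * a ∧ 6 ≤ a * a' ∧ 6 ≤ b * b' ∧
        ((2 * (b * b') ≤ b * c * a ∧ b * c * a ≤ 2 * (a * a')) ∨
        (2 * (a * a') ≤ b * c * a ∧ b * c * a ≤ 2 * (b * b'))) := by
      have e : b * c * a = a * b * c := by ring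
      rw [e]
      rcases hi with rfl | rfl | rfl
      · rw [biased0, hr, h0, h1, h2] at hbias; omega
      · exact absurd rfl hij
      · rw [biased2, hr, h0, h1, h2] at hbias; omega
    obtain ⟨H1, H2, H3, H4⟩ := H
    obtain ⟨x, y, hx, hy, hx0, hy0, K1, K2, K3, K4⟩ :=
      core_aux b c a b' c' a' hb hc ha hb' hc' ha' H1 H2 H3 H4
    have := biased_form (mutate B 1) a b x a' b' y ha hb hx0 ha' hb' hy0 (by
      rcases hB with rfl | rfl
      · right
        subst hx hy
        ext p q; fin_cases p <;> fin_cases q <;>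
          simp [mutate, abs_of_pos, *, half_aux, half_aux_neg] <;> ring
      · left
        subst hx hy
        ext p q; fin_cases p <;> fin_cases q <;>
          simp [mutate, abs_of_pos, *, half_aux, half_aux_neg] <;> ring)
    obtain ⟨g, gr, g0, g1, g2⟩ := this
    refine ⟨g, ?_⟩
    have e : a * b * x = b * x * a := by ring
    rw [biased1, gr, g0, g1, g2, e]
    omega
  · have H : 2 * (a * a') ≤ c * a * b ∧ 6 ≤ b * b' ∧ 6 ≤ c * c' ∧
        ((2 * (c * c') ≤ c * a * b ∧ c * a * b ≤ 2 * (b * b')) ∨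
        (2 * (b * b') ≤ c * a * b ∧ c * a * b ≤ 2 * (c * c'))) := by
      have e : c * a * b = a * b * c := by ring
      rw [e]
      rcases hi with rfl | rfl | rfl
      · rw [biased0, hr, h0, h1, h2] at hbias; omega
      · rw [biased1, hr, h0, h1, h2] at hbias; omega
      · exact absurd rfl hij
    obtain ⟨H1, H2, H3, H4⟩ := H
    obtain ⟨x, y, hx, hy, hx0, hy0, K1, K2, K3, K4⟩ :=
      core_aux c a b c' a' b' hc ha hb hc' ha' hb' H1 H2 H3 H4
    have := biased_form (mutate B 2) x b c y b' c' hx0 hb hc hy0 hb' hc' (by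
      rcases hB with rfl | rfl
      · right
        subst hx hy
        ext p q; fin_cases p <;> fin_cases q <;>
          simp [mutate, abs_of_pos, *, half_aux, half_aux_neg] <;> ring
      · left
        subst hx hy
        ext p q; fin_cases p <;> fin_cases q <;>
          simp [mutate, abs_of_pos, *, half_aux, half_aux_neg] <;> ring)
    obtain ⟨g, gr, g0, g1, g2⟩ := this
    refine ⟨g, ?_⟩
    have e : x * b * c = c * x * b := by ring
    rw [biased2, gr, g0, g1, g2, e]
    omega
end

section
/- Let α, β, γ be positive integers with αβγ ≥ 3, and let B(α, β, γ) be the 3×3 integer matrix [[0, 2α, −2αβ], [−βγ, 0, 2β], [γ, −αγ, 0]]. Then every matrix obtained from B(α, β, γ) by applying an arbitrary finite sequence of mutations μ_{k_1}, …, μ_{k_N} (k_1, …, k_N ∈ {1,2,3}) is cyclical — in particular sign-skew-symmetric — and none of these matrices is skew-symmetrizable. -/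
def stA (a b : Fin 3 → ℤ) (k : Fin 3) : Fin 3 → ℤ :=
  Function.update a k (b (k+1) * b (k+2) - a k)

def MM (s : ℤ) (a b : Fin 3 → ℤ) : Matrix (Fin 3) (Fin 3) ℤ :=
  !![0, s * a 2, -(s * b 1); -(s * b 2), 0, s * a 0; s * a 1, -(s * b 0), 0]

def MInv (l : Option (Fin 3)) (a b : Fin 3 → ℤ) : Prop :=
  (∀ k, 0 < a k ∧ 0 < b k ∧ 4 ≤ a k * b k) ∧
  (∀ k, l ≠ some k → 2 * a k ≤ b (k+1) * b (k+2) ∧ 2 * b k ≤ a (k+1) * a (k+2)) ∧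
  a 0 * a 1 * a 2 ≠ b 0 * b 1 * b 2

inductive Reach : Option (Fin 3) → (Fin 3 → ℤ) → (Fin 3 → ℤ) → Prop
  | base (a b : Fin 3 → ℤ) : MInv none a b → Reach none a b
  | step (l : Option (Fin 3)) (a b : Fin 3 → ℤ) (k : Fin 3) :
      Reach l a b → l ≠ some k → Reach (some k) (stA a b k) (stA b a k)

theorem stA_invol (a b : Fin 3 → ℤ) (k : Fin 3) : stA (stA a b k) (stA b a k) k = a := by
  funext i
  fin_cases k <;> fin_cases i <;> simp [stA]

theorem key (x y y' z' : ℤ) (hx : 0 < x) (hy' : 0 < y')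
    (h4y : 4 ≤ y * y') (f2 : 2 * z' ≤ x * y) :
    2 * x ≤ y' * (x * y - z') := by
  have h1 : x * y ≤ 2 * (x * y - z') := by linarith
  have h2 : y' * (x * y) ≤ y' * (2 * (x * y - z')) := mul_le_mul_of_nonneg_left h1 hy'.le
  have h3 : x * 4 ≤ x * (y * y') := mul_le_mul_of_nonneg_left h4y hx.le
  nlinarith

theorem key2 (x y z w : ℤ) (hx : 0 < x) (h : 2 * z ≤ w) (f : y ≤ x * z) :
    y ≤ x * (w - z) := by
  have : x * z ≤ x * (w - z) := mul_le_mul_of_nonneg_left (by linarith) hx.le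
  linarith

theorem key' (x y y' z' : ℤ) (hx : 0 < x) (hy' : 0 < y')
    (h4y : 4 ≤ y * y') (f2 : 2 * z' ≤ x * y) :
    2 * x ≤ (y * x - z') * y' := by
  have := key x y y' z' hx hy' h4y f2
  linarith

theorem key2' (x y z w : ℤ) (hx : 0 < x) (h : 2 * z ≤ w) (f : y ≤ x * z) :
    y ≤ (w - z) * x := by
  have := key2 x y z w hx h f
  linarith

theorem inv_step (l : Option (Fin 3)) (a b : Fin 3 → ℤ) (k : Fin 3) (h : MInv l a b)
    (hl : l ≠ some k) : MInv (some k) (stA a b k) (stA b a k) := by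
  obtain ⟨h1, h2, h3⟩ := h
  obtain ⟨f1, f2⟩ := h2 k hl
  obtain ⟨qa0, qb0, qc0⟩ := h1 0
  obtain ⟨qa1, qb1, qc1⟩ := h1 1
  obtain ⟨qa2, qb2, qc2⟩ := h1 2
  have g4 : 4 ≤ (b (k+1) * b (k+2) - a k) * (a (k+1) * a (k+2) - b k) := by
    obtain ⟨p1, p2, p3⟩ := h1 k
    have := mul_le_mul (show a k ≤ b (k+1) * b (k+2) - a k by linarith)
      (show b k ≤ a (k+1) * a (k+2) - b k by linarith) p2.le (by linarith)
    linarith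
  have gp : 0 < b (k+1) * b (k+2) - a k ∧ 0 < a (k+1) * a (k+2) - b k := by
    obtain ⟨p1, p2, p3⟩ := h1 k
    constructor <;> linarith
  refine ⟨?_, ?_, ?_⟩
  · intro j
    by_cases hj : j = k
    · subst hj
      simp only [stA, Function.update_self]
      exact ⟨gp.1, gp.2, g4⟩
    · simp only [stA, Function.update_of_ne hj]
      exact h1 j
  · intro j hj
    have hj' : k ≠ j := fun h => hj (by rw [h])
    by_cases hlj : l = some j
    · clear h2 h3
      fin_cases k <;> fin_cases j <;> simp [stA] at * <;> constructor <;>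
        first
        | (apply key <;> linarith)
        | (apply key' <;> linarith)
    · obtain ⟨u1, u2⟩ := h2 j hlj
      clear h2 h3
      fin_cases k <;> fin_cases j <;> simp [stA] at * <;> constructor <;>
        first
        | (apply key2 <;> linarith)
        | (apply key2' <;> linarith)
  · intro h
    apply h3
    fin_cases k <;> simp [stA] at h <;> linarith

theorem reach_inv {l a b} (h : Reach l a b) : MInv l a b := by
  induction h with
  | base a b h => exact h
  | step l a b k _ hl ih => exact inv_step l a b k ih hl

theorem reach_step {l a b} (h : Reach l a b) (k : Fin 3) :
    ∃ l', Reach l' (stA a b k) (stA b a k) := by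
  by_cases hl : l = some k
  · subst hl
    cases h with
    | step l a b _ h hl => exact ⟨l, by rw [stA_invol, stA_invol]; exact h⟩
  · exact ⟨_, Reach.step l a b k h hl⟩

theorem mutate_MM (s : ℤ) (hs : s = 1 ∨ s = -1) (a b : Fin 3 → ℤ)
    (h : ∀ k, 0 < a k ∧ 0 < b k) (k : Fin 3) :
    mutate (MM s a b) k = MM (-s) (stA a b k) (stA b a k) := by
  have ha : ∀ k, |a k| = a k := fun k => abs_of_pos (h k).1
  have hb : ∀ k, |b k| = b k := fun k => abs_of_pos (h k).2
  have e1 : ∀ x y : ℤ, (x * y + x * y) / 2 = x * y := fun x y => by omega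
  have e2 : ∀ x y : ℤ, (-(x * y) + -(x * y)) / 2 = -(x * y) := fun x y => by omega
  ext i j
  rcases hs with rfl | rfl <;> fin_cases k <;> fin_cases i <;> fin_cases j <;>
    simp [mutate, MM, stA, ha, hb, e1, e2] <;> first | ring1 | (rw [mul_comm, e1]; ring1) | skip

theorem fold_MM (ks : List (Fin 3)) : ∀ (s : ℤ) (_ : s = 1 ∨ s = -1) (l) (a b : Fin 3 → ℤ)
    (_ : Reach l a b), ∃ s' l' a' b', (s' = 1 ∨ s' = -1) ∧ Reach l' a' b' ∧
      ks.foldl mutate (MM s a b) = MM s' a' b' := by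
  induction ks with
  | nil => intro s hs l a b h; exact ⟨s, l, a, b, hs, h, rfl⟩
  | cons k ks ih =>
    intro s hs l a b h
    obtain ⟨l', h'⟩ := reach_step h k
    have hi := (reach_inv h).1
    rw [List.foldl_cons, mutate_MM s hs a b (fun k => ⟨(hi k).1, (hi k).2.1⟩) k]
    exact ih (-s) (by rcases hs with rfl | rfl <;> simp) l' _ _ h'

/-- For positive integers `α, β, γ` with `αβγ ≥ 3`, every matrix obtained from
`B(α,β,γ) = [[0, 2α, −2αβ], [−βγ, 0, 2β], [γ, −αγ, 0]]` by an arbitrary finite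
sequence of mutations is cyclical — in particular sign-skew-symmetric — and is
not skew-symmetrizable. -/
theorem mutation_class_of_B_abc_non_skew_symmetrizable
    (α β γ : ℤ) (hα : 0 < α) (hβ : 0 < β) (hγ : 0 < γ) (h3 : 3 ≤ α * β * γ)
    (ks : List (Fin 3)) :
    Cyclical (ks.foldl mutate !![0, 2*α, -2*α*β; -β*γ, 0, 2*β; γ, -α*γ, 0]) ∧
    SignSkewSymmetric (ks.foldl mutate !![0, 2*α, -2*α*β; -β*γ, 0, 2*β; γ, -α*γ, 0]) ∧
    ¬ SkewSymmetrizable (ks.foldl mutate !![0, 2*α, -2*α*β; -β*γ, 0, 2*β; γ, -α*γ, 0]) := by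
  have hB : (!![0, 2*α, -2*α*β; -β*γ, 0, 2*β; γ, -α*γ, 0] : Matrix (Fin 3) (Fin 3) ℤ) =
      MM 1 ![2*β, γ, 2*α] ![α*γ, 2*α*β, β*γ] := by
    ext i j
    fin_cases i <;> fin_cases j <;> simp [MM]
  have p1 := mul_pos hα hβ
  have p2 := mul_pos hα hγ
  have p3 := mul_pos hβ hγ
  have h0 : MInv none ![2*β, γ, 2*α] ![α*γ, 2*α*β, β*γ] := by
    refine ⟨?_, ?_, ?_⟩
    · intro k
      fin_cases k <;> simp <;> refine ⟨?_, ?_, ?_⟩ <;> nlinarith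
    · intro k _
      fin_cases k <;> simp <;> constructor <;> nlinarith
    · simp
      intro h
      have : (α * β * γ) * (α * β * γ - 2) = 0 := by linarith
      rcases mul_eq_zero.1 this with h | h <;> linarith
  obtain ⟨s, l, a, b, hs, hr, he⟩ := fold_MM ks 1 (Or.inl rfl) none _ _ (Reach.base _ _ h0)
  rw [hB, he]
  obtain ⟨i1, -, i3⟩ := reach_inv hr
  obtain ⟨a0, b0, -⟩ := i1 0
  obtain ⟨a1, b1, -⟩ := i1 1
  obtain ⟨a2, b2, -⟩ := i1 2
  refine ⟨⟨?_, ?_⟩, ?_, ?_⟩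
  · intro i; fin_cases i <;> simp [MM]
  · rcases hs with rfl | rfl
    · left; simp [MM, *]
    · right; simp [MM, *]
  · have := mul_pos a0 b0
    have := mul_pos a1 b1
    have := mul_pos a2 b2
    intro i j
    rcases hs with rfl | rfl <;> fin_cases i <;> fin_cases j <;> simp [MM] <;> right <;> linarith
  · rintro ⟨d, hd, h⟩
    apply i3
    have e1 : d 0 * a 2 = d 1 * b 2 := by
      have := h 0 1
      rcases hs with rfl | rfl <;> simp [MM] at this <;> linarith
    have e2 : d 1 * a 0 = d 2 * b 0 := by
      have := h 1 2
      rcases hs with rfl | rfl <;> simp [MM] at this <;> linarith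
    have e3 : d 2 * a 1 = d 0 * b 1 := by
      have := h 2 0
      rcases hs with rfl | rfl <;> simp [MM] at this <;> linarith
    have hp : d 0 * d 1 * d 2 ≠ 0 := (mul_pos (mul_pos (hd 0) (hd 1)) (hd 2)).ne'
    apply mul_left_cancel₀ hp
    calc _ = (d 0 * a 2) * (d 1 * a 0) * (d 2 * a 1) := by ring
      _ = _ := by rw [e1, e2, e3]; ring
end

section
/- Let B be a skew-symmetrizable square integer matrix. Then every matrix obtained from B by applying an arbitrary finite sequence of mutations μ_{k_1}, …, μ_{k_N} is skew-symmetrizable (with the same skew-symmetrizing matrix as B), and in particular sign-skew-symmetric. (This is the key fact guaranteeing that every skew-symmetrizable matrix gives rise to an exchange pattern.) -/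
theorem mut_aux (a b : ℤ) : 2 * ((|a| * b + a * |b|) / 2) = |a| * b + a * |b| := by
  apply Int.mul_ediv_cancel'
  rcases abs_cases a with ⟨h, _⟩ | ⟨h, _⟩ <;> rcases abs_cases b with ⟨h', _⟩ | ⟨h', _⟩ <;>
    rw [h, h']
  · exact ⟨a * b, by ring⟩
  · exact ⟨0, by ring⟩
  · exact ⟨0, by ring⟩
  · exact ⟨-(a * b), by ring⟩

theorem mut_abs_aux {x y a b : ℤ} (hx : 0 < x) (hy : 0 < y) (h : x * a = -(y * b)) :
    x * |a| = y * |b| := by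
  have := congrArg abs h
  rwa [abs_neg, abs_mul, abs_mul, abs_of_pos hx, abs_of_pos hy] at this

theorem mutate_skew {n : ℕ} (B : Matrix (Fin n) (Fin n) ℤ) (d : Fin n → ℤ)
    (hpos : ∀ i, 0 < d i)
    (hskew : ∀ i j, d i * B i j = -(d j * B j i)) (k : Fin n) (i j : Fin n) :
    d i * mutate B k i j = -(d j * mutate B k j i) := by
  simp only [mutate, Matrix.of_apply]
  by_cases h : i = k ∨ j = k
  · rw [if_pos h, if_pos h.symm]
    linarith [hskew i j]
  · rw [if_neg h, if_neg (fun h' => h h'.symm)]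
    have e1 := mut_aux (B i k) (B k j)
    have e2 := mut_aux (B j k) (B k i)
    have h1 := hskew i k
    have h2 := hskew k j
    have h3 := mut_abs_aux (hpos i) (hpos k) h1
    have h4 := mut_abs_aux (hpos k) (hpos j) h2
    have h5 := hskew i j
    generalize (|B i k| * B k j + B i k * |B k j|) / 2 = S at *
    generalize (|B j k| * B k i + B j k * |B k i|) / 2 = T at *
    have : 2 * (d i * S + d j * T) = 0 := by
      linear_combination d i * e1 + d j * e2 + B k j * h3 + |B k j| * h1 + |B k i| * h2 - B k i * h4
    linarith

/-- If `B` is skew-symmetrizable, with skew-symmetrizing diagonal matrix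
`D = diag(d_i)`, then every matrix obtained from `B` by an arbitrary finite
sequence of mutations is skew-symmetrizable with the same skew-symmetrizing
matrix `D`, and in particular is sign-skew-symmetric. -/
theorem mutation_class_of_skew_symmetrizable
    {n : ℕ} (B : Matrix (Fin n) (Fin n) ℤ) (d : Fin n → ℤ)
    (hpos : ∀ i, 0 < d i)
    (hskew : ∀ i j, d i * B i j = -(d j * B j i))
    (ks : List (Fin n)) :
    (∀ i j, d i * (ks.foldl mutate B) i j = -(d j * (ks.foldl mutate B) j i)) ∧
    SignSkewSymmetric (ks.foldl mutate B) := by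
  induction ks generalizing B with
  | cons k ks ih => exact ih (mutate B k) (mutate_skew B d hpos hskew k)
  | nil =>
    refine ⟨hskew, fun i j => ?_⟩
    have h := hskew i j
    have hi := hpos i
    have hj := hpos j
    simp only [List.foldl_nil]
    by_cases h0 : B j i = 0
    · left
      rw [h0] at h
      refine ⟨?_, h0⟩
      have : d i * B i j = 0 := by linarith
      exact (mul_eq_zero.mp this).resolve_left hi.ne'
    · right
      have h2 : 0 < d j * (B j i) ^ 2 := by positivity
      have h3 : d i * (B i j * B j i) = -(d j * (B j i) ^ 2) := by
        linear_combination B j i * h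
      by_contra hc
      have : 0 ≤ d i * (B i j * B j i) := mul_nonneg hi.le (not_lt.mp hc)
      linarith
end

section
/- Let P be a semifield, i.e., an abelian group under multiplication equipped with a binary operation ⊕ (auxiliary addition) that is commutative, associative, and distributive with respect to multiplication (a·(b ⊕ c) = (a·b) ⊕ (a·c) for all a, b, c). Then P is torsion-free as a multiplicative group: if p ∈ P satisfies p^m = 1 for some integer m ≥ 1, then p = 1. -/
/-- **Semifields are torsion-free.**  Let `P` be an abelian group under
multiplication equipped with an auxiliary addition `⊕` that is commutative,
associative, and distributive with respect to multiplication.  If `p ∈ P`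
satisfies `p ^ m = 1` for some integer `m ≥ 1`, then `p = 1`. -/
theorem semifield_torsion_free
    (P : Type*) [CommGroup P] (add : P → P → P)
    (hcomm : ∀ a b : P, add a b = add b a)
    (hassoc : ∀ a b c : P, add (add a b) c = add a (add b c))
    (hdistrib : ∀ a b c : P, a * add b c = add (a * b) (a * c))
    (p : P) (m : ℕ) (hm : 1 ≤ m) (hp : p ^ m = 1) :
    p = 1 := by
  obtain ⟨k, rfl⟩ : ∃ k, m = k + 1 := ⟨m - 1, by omega⟩
  let s : ℕ → P := fun n => Nat.rec 1 (fun n x => add x (p ^ (n + 1))) n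
  have s0 : s 0 = 1 := rfl
  have s1 : ∀ n, s (n + 1) = add (s n) (p ^ (n + 1)) := fun n => rfl
  have key : ∀ n, add 1 (p * s n) = s (n + 1) := by
    intro n
    induction n with
    | zero => rw [s1, s0]; simp
    | succ n ih =>
      rw [s1 (n + 1), ← ih, hassoc]
      congr 1
      rw [ih, s1 n, hdistrib, ← pow_succ']
  cases k with
  | zero => simpa using hp
  | succ k =>
    have h : p * s (k + 1) = s (k + 1) := by
      rw [← key k]
      conv_lhs => rw [key k, s1 k, hdistrib, ← pow_succ', hp, hcomm]
    exact mul_eq_right.mp h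
end
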